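/- arXiv:1507.01426 — 3 statements merged into one kernel-verified Lean document; each statement's English description precedes it below -/
import Mathlib

section
/- Every 2-connected simple graph on n ≥ 12 vertices with at least C(n−1, 2) − 5 edges contains a 2-connected bipartite spanning subgraph. -/
/-- A walk in an edge-colored graph is *proper* if no two consecutive edges share a color. -/
def ProperWalk {V : Type*} {G : SimpleGraph V} (c : Sym2 V → ℕ) {u v : V}
    (p : G.Walk u v) : Prop :=
  p.edges.Chain' fun e f => c e ≠ c f

/-- `c` is a proper-path coloring of `G`: every pair of distinct vertices is joined by a
proper path. -/
def IsProperPathColoring {V : Type*} (G : SimpleGraph V) (c : Sym2 V → ℕ) : Prop :=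
  ∀ u v : V, u ≠ v → ∃ p : G.Walk u v, p.IsPath ∧ ProperWalk c p

/-- The proper connection number: the least `k` such that some coloring of the edges with
colors `0, …, k-1` is a proper-path coloring. -/
noncomputable def pc {V : Type*} (G : SimpleGraph V) : ℕ :=
  sInf {k | ∃ c : Sym2 V → ℕ, (∀ e ∈ G.edgeSet, c e < k) ∧ IsProperPathColoring G c}

/-- `G` has the strong property under `c`: any two distinct vertices are joined by two proper
paths whose first-edge colors differ and whose last-edge colors differ. -/
def HasStrongProperty {V : Type*} (G : SimpleGraph V) (c : Sym2 V → ℕ) : Prop :=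
  ∀ u v : V, u ≠ v → ∃ p q : G.Walk u v, p.IsPath ∧ q.IsPath ∧
    ProperWalk c p ∧ ProperWalk c q ∧
    p.edges.head?.map c ≠ q.edges.head?.map c ∧
    p.edges.getLast?.map c ≠ q.edges.getLast?.map c

/-- `c` makes `G` 2-proper connected: any two distinct vertices are joined by two
internally vertex-disjoint proper paths. -/
def Is2ProperConnected {V : Type*} (G : SimpleGraph V) (c : Sym2 V → ℕ) : Prop :=
  ∀ u v : V, u ≠ v → ∃ p q : G.Walk u v, p.IsPath ∧ q.IsPath ∧
    ProperWalk c p ∧ ProperWalk c q ∧ p ≠ q ∧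
    ∀ x, x ∈ p.support → x ∈ q.support → x = u ∨ x = v

/-- The 2-proper connection number. -/
noncomputable def pc2 {V : Type*} (G : SimpleGraph V) : ℕ :=
  sInf {k | ∃ c : Sym2 V → ℕ, (∀ e ∈ G.edgeSet, c e < k) ∧ Is2ProperConnected G c}

/-- A graph is 2-connected if it has at least 3 vertices and deleting any single vertex
leaves a connected graph. -/
def TwoConnected {V : Type*} (G : SimpleGraph V) : Prop :=
  3 ≤ Nat.card V ∧ ∀ v : V, (G.induce {w : V | w ≠ v}).Connected

def BG {V : Type*} (G : SimpleGraph V) (A B : Finset V) (v : V) : SimpleGraph V where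
  Adj p q := G.Adj p q ∧ ((p ∈ A ∧ q ∈ B) ∨ (p ∈ B ∧ q ∈ A)) ∧ p ≠ v ∧ q ≠ v
  symm := ⟨fun p q h => ⟨h.1.symm, by tauto, by tauto⟩⟩
  loopless := ⟨fun p h => G.loopless.irrefl p h.1⟩

def GoodP {V : Type*} (G : SimpleGraph V) (A B : Finset V) : Prop :=
  Disjoint A B ∧ ∀ v a b : V, (a ∈ A ∨ a ∈ B) → (b ∈ A ∨ b ∈ B) → a ≠ v → b ≠ v →
    (BG G A B v).Reachable a b

theorem BG_mono {V : Type*} (G : SimpleGraph V) {A B A' B' : Finset V} (hA : A ⊆ A')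
    (hB : B ⊆ B') (v : V) : BG G A B v ≤ BG G A' B' v := by
  intro p q h
  refine ⟨h.1, ?_, h.2.2⟩
  rcases h.2.1 with h | h
  · exact Or.inl ⟨hA h.1, hB h.2⟩
  · exact Or.inr ⟨hB h.1, hA h.2⟩

theorem BG_comm {V : Type*} (G : SimpleGraph V) (A B : Finset V) (v : V) :
    BG G A B v = BG G B A v := by
  ext p q
  simp only [BG]
  tauto

theorem GoodP.swap {V : Type*} {G : SimpleGraph V} {A B : Finset V} (h : GoodP G A B) :
    GoodP G B A := by
  refine ⟨h.1.symm, fun v a b ha hb hav hbv => ?_⟩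
  rw [BG_comm]
  exact h.2 v a b ha.symm hb.symm hav hbv

theorem GoodP.addL {V : Type*} [DecidableEq V] {G : SimpleGraph V} {A B : Finset V}
    (h : GoodP G A B) {w b1 b2 : V} (hw : w ∉ B) (h1 : b1 ∈ B) (h2 : b2 ∈ B)
    (h12 : b1 ≠ b2) (hw1 : G.Adj w b1) (hw2 : G.Adj w b2) : GoodP G (insert w A) B := by
  refine ⟨?_, ?_⟩
  · rw [Finset.disjoint_insert_left]; exact ⟨hw, h.1⟩
  intro v
  have key : w ≠ v → ∃ c ∈ B, c ≠ v ∧ (BG G (insert w A) B v).Reachable w c := by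
    intro hwv
    by_cases hb : b1 = v
    · refine ⟨b2, h2, fun hh => h12 (hb.trans hh.symm), SimpleGraph.Adj.reachable ?_⟩
      exact ⟨hw2, Or.inl ⟨Finset.mem_insert_self _ _, h2⟩, hwv,
        fun hh => h12 (hb.trans hh.symm)⟩
    · refine ⟨b1, h1, hb, SimpleGraph.Adj.reachable ?_⟩
      exact ⟨hw1, Or.inl ⟨Finset.mem_insert_self _ _, h1⟩, hwv, hb⟩
  have old : ∀ a b : V, (a ∈ A ∨ a ∈ B) → (b ∈ A ∨ b ∈ B) → a ≠ v → b ≠ v →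
    (BG G (insert w A) B v).Reachable a b := fun a b ha hb hav hbv =>
      (h.2 v a b ha hb hav hbv).mono (BG_mono G (Finset.subset_insert _ _) (le_refl _) v)
  intro a b ha hb hav hbv
  have toOld : ∀ a, (a ∈ insert w A ∨ a ∈ B) → a ≠ v →
      ∃ c, (c ∈ A ∨ c ∈ B) ∧ c ≠ v ∧ (BG G (insert w A) B v).Reachable a c := by
    intro a ha hav
    by_cases haw : a = w
    · subst haw
      obtain ⟨c, hc, hcv, hr⟩ := key hav
      exact ⟨c, Or.inr hc, hcv, hr⟩
    · refine ⟨a, ?_, hav, SimpleGraph.Reachable.refl _⟩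
      rcases ha with ha | ha
      · exact Or.inl ((Finset.mem_insert.1 ha).resolve_left haw)
      · exact Or.inr ha
  obtain ⟨c, hc, hcv, hac⟩ := toOld a ha hav
  obtain ⟨d, hd, hdv, hbd⟩ := toOld b hb hbv
  exact hac.trans ((old c d hc hd hcv hdv).trans hbd.symm)

theorem GoodP.addR {V : Type*} [DecidableEq V] {G : SimpleGraph V} {A B : Finset V}
    (h : GoodP G A B) {w b1 b2 : V} (hw : w ∉ A) (h1 : b1 ∈ A) (h2 : b2 ∈ A)
    (h12 : b1 ≠ b2) (hw1 : G.Adj w b1) (hw2 : G.Adj w b2) : GoodP G A (insert w B) :=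
  (h.swap.addL hw h1 h2 h12 hw1 hw2).swap

theorem good_base {V : Type*} [DecidableEq V] {G : SimpleGraph V} {x y p q : V}
    (hxy : x ≠ y) (hpq : p ≠ q) (hxp : G.Adj x p) (hxq : G.Adj x q) (hyp : G.Adj y p)
    (hyq : G.Adj y q) : GoodP G {x, y} {p, q} := by
  have n1 := hxp.ne
  have n2 := hxq.ne
  have n3 := hyp.ne
  have n4 := hyq.ne
  refine ⟨?_, ?_⟩
  · simp [Finset.disjoint_left]; tauto
  intro v
  have e1 : x ≠ v → p ≠ v → (BG G {x, y} {p, q} v).Reachable x p := fun h h' =>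
    SimpleGraph.Adj.reachable ⟨hxp, by simp, h, h'⟩
  have e2 : x ≠ v → q ≠ v → (BG G {x, y} {p, q} v).Reachable x q := fun h h' =>
    SimpleGraph.Adj.reachable ⟨hxq, by simp, h, h'⟩
  have e3 : y ≠ v → p ≠ v → (BG G {x, y} {p, q} v).Reachable y p := fun h h' =>
    SimpleGraph.Adj.reachable ⟨hyp, by simp, h, h'⟩
  have e4 : y ≠ v → q ≠ v → (BG G {x, y} {p, q} v).Reachable y q := fun h h' =>
    SimpleGraph.Adj.reachable ⟨hyq, by simp, h, h'⟩
  generalize BG G {x, y} {p, q} v = K at *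
  have tr : ∀ a b c, K.Reachable a b → K.Reachable b c → K.Reachable a c :=
    fun a b c h h' => h.trans h'
  have sy : ∀ a b, K.Reachable a b → K.Reachable b a := fun a b h => h.symm
  have re : ∀ a, K.Reachable a a := fun a => SimpleGraph.Reachable.refl _
  generalize K.Reachable = R at *
  intro a b ha hb hav hbv
  simp only [Finset.mem_insert, Finset.mem_singleton] at ha hb
  by_cases hp : p = v <;> by_cases hq : q = v <;> by_cases hx : x = v <;> by_cases hy : y = v <;>
    grind

theorem good_base5 {V : Type*} [DecidableEq V] {G : SimpleGraph V} {x y p q u : V}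
    (hxy : x ≠ y) (hpq : p ≠ q) (hup : u ≠ p) (huq : u ≠ q)
    (hxp : G.Adj x p) (hxq : G.Adj x q) (hyp : G.Adj y p)
    (hyq : G.Adj y q) (hxu : G.Adj x u) (hyu : G.Adj y u) :
    ∃ A B, GoodP G A B ∧ u ∈ A ∪ B ∧ 5 ≤ (A ∪ B).card := by
  have n1 := hxp.ne
  have n2 := hxq.ne
  have n3 := hyp.ne
  have n4 := hyq.ne
  have n5 := hxu.ne
  have n6 := hyu.ne
  refine ⟨{x, y}, {u, p, q}, (good_base hxy hpq hxp hxq hyp hyq).addR (b1 := x) (b2 := y)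
    ?_ ?_ ?_ hxy hxu.symm hyu.symm, ?_, ?_⟩
  · simp; tauto
  · simp
  · simp
  · simp
  · have : ({x, y} ∪ {u, p, q} : Finset V) = {x, y, u, p, q} := by ext; simp; tauto
    rw [this]
    rw [Finset.card_insert_of_notMem, Finset.card_insert_of_notMem,
      Finset.card_insert_of_notMem, Finset.card_pair] <;> simp <;> tauto

theorem good_closure {V : Type*} [Fintype V] [DecidableEq V] {G : SimpleGraph V} :
    ∀ (k : ℕ) (A B : Finset V), (A ∪ B)ᶜ.card = k → GoodP G A B →
    ∃ A' B', GoodP G A' B' ∧ A ∪ B ⊆ A' ∪ B' ∧ ∀ w, w ∉ A' ∪ B' →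
      (∀ a ∈ A', ∀ b ∈ A', G.Adj w a → G.Adj w b → a = b) ∧
      (∀ a ∈ B', ∀ b ∈ B', G.Adj w a → G.Adj w b → a = b) := by
  intro k
  induction k using Nat.strong_induction_on with
  | _ k ih =>
    intro A B hk hg
    have lt : ∀ w, w ∉ A ∪ B → ∀ S : Finset V, S = insert w (A ∪ B) → Sᶜ.card < k := by
      rintro w hw S rfl
      rw [← hk]
      apply Finset.card_lt_card
      rw [Finset.compl_ssubset_compl]
      exact Finset.ssubset_insert hw
    by_cases h : ∃ w, w ∉ A ∪ B ∧ (∃ a ∈ A, ∃ b ∈ A, G.Adj w a ∧ G.Adj w b ∧ a ≠ b)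
    · obtain ⟨w, hw, a, ha, b, hb, hwa, hwb, hab⟩ := h
      have hw' := hw
      simp only [Finset.mem_union, not_or] at hw'
      obtain ⟨A', B', h1, h2, h3⟩ := ih _ (lt w hw (A ∪ insert w B) (by simp)) A (insert w B) rfl
        (hg.addR hw'.1 ha hb hab hwa hwb)
      exact ⟨A', B', h1, (by simp : A ∪ B ⊆ A ∪ insert w B).trans h2, h3⟩
    by_cases h' : ∃ w, w ∉ A ∪ B ∧ (∃ a ∈ B, ∃ b ∈ B, G.Adj w a ∧ G.Adj w b ∧ a ≠ b)
    · obtain ⟨w, hw, a, ha, b, hb, hwa, hwb, hab⟩ := h'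
      have hw' := hw
      simp only [Finset.mem_union, not_or] at hw'
      obtain ⟨A', B', h1, h2, h3⟩ := ih _ (lt w hw (insert w A ∪ B) (by simp)) (insert w A) B rfl
        (hg.addL hw'.2 ha hb hab hwa hwb)
      exact ⟨A', B', h1, (by simp : A ∪ B ⊆ insert w A ∪ B).trans h2, h3⟩
    refine ⟨A, B, hg, le_refl _, fun w hw => ⟨?_, ?_⟩⟩
    · intro a ha b hb hwa hwb
      by_contra hab
      exact h ⟨w, hw, a, ha, b, hb, hwa, hwb, hab⟩
    · intro a ha b hb hwa hwb
      by_contra hab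
      exact h' ⟨w, hw, a, ha, b, hb, hwa, hwb, hab⟩

theorem good_final {V : Type*} [Fintype V] [DecidableEq V] {G : SimpleGraph V}
    (hn : 3 ≤ Fintype.card V) {A B : Finset V} (hg : GoodP G A B) (hAB : ∀ v, v ∈ A ∪ B) :
    ∃ H : SimpleGraph V, H ≤ G ∧ TwoConnected H ∧
      ∃ s : Set V, ∀ a b : V, H.Adj a b → (a ∈ s ↔ b ∉ s) := by
  let H : SimpleGraph V :=
    { Adj := fun p q => G.Adj p q ∧ ((p ∈ A ∧ q ∈ B) ∨ (p ∈ B ∧ q ∈ A))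
      symm := ⟨fun p q h => ⟨h.1.symm, by tauto⟩⟩
      loopless := ⟨fun p h => G.loopless.irrefl p h.1⟩ }
  have hd := Finset.disjoint_left.1 hg.1
  refine ⟨H, fun p q h => h.1, ⟨by rwa [Nat.card_eq_fintype_card], fun v => ?_⟩, (A : Set V), ?_⟩
  · have key : ∀ a b, (BG G A B v).Reachable a b → ∀ (ha : a ≠ v) (hb : b ≠ v),
        (H.induce {w : V | w ≠ v}).Reachable ⟨a, ha⟩ ⟨b, hb⟩ := by
      rintro a b ⟨p⟩
      induction p with
      | nil => intro _ _; exact SimpleGraph.Reachable.refl _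
      | cons h p ih =>
        intro ha hb
        refine SimpleGraph.Reachable.trans (SimpleGraph.Adj.reachable ?_) (ih h.2.2.2 hb)
        exact ⟨h.1, h.2.1⟩
    have : Nontrivial V := Fintype.one_lt_card_iff_nontrivial.1 (by omega)
    obtain ⟨w, hw⟩ := exists_ne v
    have : Nonempty ↑{w : V | w ≠ v} := ⟨⟨w, hw⟩⟩
    refine SimpleGraph.Connected.mk ?_
    rintro ⟨a, ha⟩ ⟨b, hb⟩
    exact key a b (hg.2 v a b (by simpa using hAB a) (by simpa using hAB b) ha hb) ha hb
  · intro a b h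
    have := h.2
    have h1 := @hd a
    have h2 := @hd b
    simp only [Finset.mem_coe]
    tauto

theorem compl_count {V : Type*} [Fintype V] [DecidableEq V] (G : SimpleGraph V)
    [DecidableRel G.Adj] (hn : 12 ≤ Fintype.card V)
    (hm : Nat.choose (Fintype.card V - 1) 2 - 5 ≤ G.edgeSet.ncard) :
    Gᶜ.edgeFinset.card ≤ Fintype.card V + 4 := by
  have h1 : G.edgeSet.ncard = G.edgeFinset.card := by
    rw [← SimpleGraph.coe_edgeFinset, Set.ncard_coe_finset]
  have h2 : G.edgeFinset.card + Gᶜ.edgeFinset.card = (Fintype.card V).choose 2 := by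
    rw [← SimpleGraph.card_edgeFinset_top_eq_card_choose_two, ← Finset.card_union_of_disjoint]
    · congr 1
      ext e
      induction e with | _ a b => 
      simp
      by_cases h : G.Adj a b
      · simp [h, h.ne]
      · simp [h]
    · rw [SimpleGraph.disjoint_edgeFinset]
      exact disjoint_compl_right
  obtain ⟨k, hk⟩ : ∃ k, Fintype.card V = k + 1 := ⟨Fintype.card V - 1, by omega⟩
  rw [hk] at h2 hm hn ⊢
  rw [Nat.choose_succ_succ' k 1, Nat.choose_one_right] at h2
  simp only [Nat.add_sub_cancel] at hm
  have h3 : Nat.choose 11 2 ≤ Nat.choose k 2 := Nat.choose_le_choose 2 (by omega)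
  have h4 : Nat.choose 11 2 = 55 := by decide
  simp only [Nat.reduceAdd] at h2
  omega

theorem cut_count {V : Type*} [Fintype V] [DecidableEq V] (G : SimpleGraph V)
    [DecidableRel G.Adj] (T : Finset V) :
    ∑ v ∈ T, (Tᶜ.filter (fun w => ¬ G.Adj v w)).card ≤ Gᶜ.edgeFinset.card := by
  rw [← Finset.card_sigma]
  refine Finset.card_le_card_of_injOn (fun p => s(p.1, p.2)) ?_ ?_
  · rintro ⟨a, b⟩ h
    simp at h ⊢
    refine ⟨?_, h.2.2⟩
    rintro rfl
    exact h.2.1 h.1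
  · rintro ⟨a, b⟩ h ⟨c, d⟩ h' he
    simp at h h' he ⊢
    rcases he with he | ⟨rfl, rfl⟩
    · exact he
    · exact absurd h.1 h'.2.1

theorem pair_count {V : Type*} [Fintype V] [DecidableEq V] (G : SimpleGraph V)
    [DecidableRel G.Adj] {a b : V} (hab : a ≠ b) :
    Gᶜ.degree a + Gᶜ.degree b ≤ Gᶜ.edgeFinset.card + 1 := by
  rw [← SimpleGraph.card_incidenceFinset_eq_degree, ← SimpleGraph.card_incidenceFinset_eq_degree,
    ← Finset.card_union_add_card_inter]
  refine add_le_add (Finset.card_le_card ?_) ?_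
  · exact Finset.union_subset (SimpleGraph.incidenceFinset_subset _ _)
      (SimpleGraph.incidenceFinset_subset _ _)
  · refine le_trans (Finset.card_le_card (t := {s(a, b)}) ?_) (by simp)
    intro e he
    simp only [Finset.mem_inter, SimpleGraph.mem_incidenceFinset] at he
    have := SimpleGraph.incidenceSet_inter_incidenceSet_subset Gᶜ hab he
    simpa using this

theorem out_lower {V : Type*} [Fintype V] [DecidableEq V] (G : SimpleGraph V)
    [DecidableRel G.Adj] (T : Finset V) (v : V) :
    Fintype.card V ≤ (Tᶜ.filter (fun w => ¬ G.Adj v w)).card + T.card +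
      (Tᶜ.filter (fun w => G.Adj v w)).card := by
  have h := Finset.card_filter_add_card_filter_not (s := Tᶜ) (fun w => G.Adj v w)
  have := Finset.card_compl_add_card T
  omega

theorem out_deg {V : Type*} [Fintype V] [DecidableEq V] (G : SimpleGraph V)
    [DecidableRel G.Adj] (T : Finset V) (v : V) :
    (T.filter (fun w => G.Adj v w)).card + (Tᶜ.filter (fun w => G.Adj v w)).card
      = G.degree v := by
  rw [← SimpleGraph.card_neighborFinset_eq_degree, ← Finset.card_union_of_disjoint]
  · congr 1; ext w; simp; tauto
  · exact Finset.disjoint_filter_filter disjoint_compl_right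

theorem common {V : Type*} [Fintype V] [DecidableEq V] (G : SimpleGraph V)
    [DecidableRel G.Adj] (T : Finset V) (x y : V) {k : ℕ}
    (h : (Tᶜ.filter (fun w => ¬ G.Adj x w)).card + (Tᶜ.filter (fun w => ¬ G.Adj y w)).card
      + T.card + k ≤ Fintype.card V) :
    k ≤ (Tᶜ.filter (fun w => G.Adj x w ∧ G.Adj y w)).card := by
  have h1 := Finset.card_compl_add_card T
  have h2 := Finset.card_filter_add_card_filter_not (s := Tᶜ) (fun w => G.Adj x w ∧ G.Adj y w)
  have h3 : (Tᶜ.filter (fun w => ¬ (G.Adj x w ∧ G.Adj y w))).card ≤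
      (Tᶜ.filter (fun w => ¬ G.Adj x w)).card + (Tᶜ.filter (fun w => ¬ G.Adj y w)).card := by
    refine le_trans (Finset.card_le_card ?_) (Finset.card_union_le _ _)
    intro w; simp; tauto
  omega

theorem deg_two {V : Type*} [Fintype V] [DecidableEq V] (G : SimpleGraph V)
    [DecidableRel G.Adj] (h : TwoConnected G) (u : V) : 2 ≤ G.degree u := by
  by_contra hd
  have hc := h.1
  rw [Nat.card_eq_fintype_card] at hc
  rw [← SimpleGraph.card_neighborFinset_eq_degree] at hd
  have : Nontrivial V := Fintype.one_lt_card_iff_nontrivial.1 (by omega)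
  have : ∃ v, v ≠ u ∧ ∀ w, G.Adj u w → w = v := by
    by_cases he : ∃ v, G.Adj u v
    · obtain ⟨v, hv⟩ := he
      refine ⟨v, hv.ne.symm, fun w hw => ?_⟩
      exact Finset.card_le_one.1 (show (G.neighborFinset u).card ≤ 1 by omega) w (by simpa using hw) v (by simpa using hv)
    · obtain ⟨v, hv⟩ := exists_ne u
      exact ⟨v, hv, fun w hw => absurd ⟨w, hw⟩ he⟩
  obtain ⟨v, hvu, hv⟩ := this
  obtain ⟨z, hz⟩ : ∃ z, z ∉ ({u, v} : Finset V) := by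
    by_contra! hcon
    have h1 : (Finset.univ : Finset V) ⊆ {u, v} := fun z _ => hcon z
    have := (Finset.card_le_card h1).trans Finset.card_le_two
    rw [Finset.card_univ] at this
    omega
  simp at hz
  have hr := (h.2 v).preconnected ⟨u, hvu.symm⟩ ⟨z, hz.2⟩
  obtain ⟨p⟩ := hr
  cases p with
  | nil => exact hz.1 rfl
  | cons hadj p =>
    rename_i m
    exact m.2 (hv _ hadj)

theorem small_start {V : Type*} [Fintype V] [DecidableEq V] (G : SimpleGraph V)
    [DecidableRel G.Adj] (hn : 12 ≤ Fintype.card V)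
    (hc : Gᶜ.edgeFinset.card ≤ Fintype.card V + 4) (u : V) (h2 : 2 ≤ G.degree u)
    (h3 : G.degree u ≤ 3) :
    ∃ A B, GoodP G A B ∧ u ∈ A ∪ B ∧ 5 ≤ (A ∪ B).card := by
  have fin : ∀ (T : Finset V) (x y : V), u ∈ T → x ≠ y → G.Adj u x → G.Adj u y →
      (Tᶜ.filter (fun w => ¬ G.Adj x w)).card + (Tᶜ.filter (fun w => ¬ G.Adj y w)).card
      + T.card + 2 ≤ Fintype.card V → ∃ A B, GoodP G A B ∧ u ∈ A ∪ B ∧ 5 ≤ (A ∪ B).card := by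
    intro T x y hu hxy hx hy hle
    obtain ⟨p, hp, q, hq, hpq⟩ := Finset.one_lt_card.1 (common G T x y hle)
    simp at hp hq
    refine good_base5 hxy hpq ?_ ?_ hp.2.1 hq.2.1 hp.2.2 hq.2.2 hx.symm hy.symm
    · rintro rfl; exact hp.1 hu
    · rintro rfl; exact hq.1 hu
  have hcut := cut_count G (insert u (G.neighborFinset u))
  have hcard : (insert u (G.neighborFinset u)).card = G.degree u + 1 := by
    rw [Finset.card_insert_of_notMem (by simp), SimpleGraph.card_neighborFinset_eq_degree]
  have hlow := out_lower G (insert u (G.neighborFinset u)) u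
  have hz : ((insert u (G.neighborFinset u))ᶜ.filter (fun w => G.Adj u w)).card = 0 := by
    rw [Finset.card_eq_zero]; ext w; simp
  rw [Finset.sum_insert (by simp)] at hcut
  have hu : u ∈ insert u (G.neighborFinset u) := by simp
  have hnb : ∀ w, w ∈ G.neighborFinset u ↔ G.Adj u w := by simp
  have hd := SimpleGraph.card_neighborFinset_eq_degree G u
  generalize insert u (G.neighborFinset u) = T at *
  generalize G.neighborFinset u = N at *
  have hcases : N.card = 2 ∨ N.card = 3 := by omega
  rcases hcases with h | h
  · obtain ⟨x, y, hxy, rfl⟩ := Finset.card_eq_two.1 h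
    rw [Finset.sum_pair hxy] at hcut
    exact fin T x y hu hxy (by simp [← hnb]) (by simp [← hnb]) (by omega)
  · obtain ⟨x, y, z, hxy, hxz, hyz, rfl⟩ := Finset.card_eq_three.1 h
    rw [Finset.sum_insert (by simp [hxy, hxz]), Finset.sum_pair hyz] at hcut
    have f1 := fin T x y hu hxy (by simp [← hnb]) (by simp [← hnb])
    have f2 := fin T x z hu hxz (by simp [← hnb]) (by simp [← hnb])
    have f3 := fin T y z hu hyz (by simp [← hnb]) (by simp [← hnb])
    by_cases g1 : (Tᶜ.filter (fun w => ¬ G.Adj x w)).card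
        + (Tᶜ.filter (fun w => ¬ G.Adj y w)).card + T.card + 2 ≤ Fintype.card V
    · exact f1 g1
    by_cases g2 : (Tᶜ.filter (fun w => ¬ G.Adj x w)).card
        + (Tᶜ.filter (fun w => ¬ G.Adj z w)).card + T.card + 2 ≤ Fintype.card V
    · exact f2 g2
    exact f3 (by omega)

theorem big_start {V : Type*} [Fintype V] [DecidableEq V] (G : SimpleGraph V)
    [DecidableRel G.Adj] (hn : 12 ≤ Fintype.card V)
    (hc : Gᶜ.edgeFinset.card ≤ Fintype.card V + 4) :
    ∃ A B, GoodP G A B ∧ 5 ≤ (A ∪ B).card := by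
  have hs := Gᶜ.sum_degrees_eq_twice_card_edges
  have h1 := Finset.card_filter_add_card_filter_not (s := (Finset.univ : Finset V))
    (fun v => Gᶜ.degree v ≤ 3)
  have h2 : (Finset.univ.filter (fun v => ¬ Gᶜ.degree v ≤ 3)).card * 4 ≤ ∑ v, Gᶜ.degree v := by
    rw [← smul_eq_mul]
    refine le_trans (Finset.card_nsmul_le_sum _ (fun v => Gᶜ.degree v) 4 ?_)
      (Finset.sum_le_sum_of_subset (Finset.filter_subset _ _))
    intro v hv
    simp at hv
    have : 3 < Gᶜ.degree v := by simpa using hv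
    omega
  rw [Finset.card_univ] at h1
  obtain ⟨x, hx, y, hy, hxy⟩ := Finset.one_lt_card.1
    (show 1 < (Finset.univ.filter (fun v => Gᶜ.degree v ≤ 3)).card by omega)
  have hx : Gᶜ.degree x ≤ 3 := (Finset.mem_filter.1 hx).2
  have hy : Gᶜ.degree y ≤ 3 := (Finset.mem_filter.1 hy).2
  have hb : ∀ a ∈ ({x, y} : Finset V),
      (({x, y} : Finset V)ᶜ.filter (fun w => ¬ G.Adj a w)).card ≤ Gᶜ.degree a := by
    intro a ha
    rw [← SimpleGraph.card_neighborFinset_eq_degree]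
    refine Finset.card_le_card ?_
    intro w hw
    rw [Finset.mem_filter, Finset.mem_compl] at hw
    rw [SimpleGraph.mem_neighborFinset, SimpleGraph.compl_adj]
    refine ⟨?_, hw.2⟩
    rintro rfl
    exact hw.1 ha
  have b1 := hb x (by simp)
  have b2 := hb y (by simp)
  have hcard := Finset.card_pair hxy
  obtain ⟨u, p, q, hu, hp, hq, hup, huq, hpq⟩ := Finset.two_lt_card_iff.1
    (common G {x, y} x y (k := 3) (by omega))
  rw [Finset.mem_filter] at hu hp hq
  obtain ⟨A, B, h, -, h'⟩ := good_base5 hxy hpq hup huq hp.2.1 hq.2.1 hp.2.2 hq.2.2 hu.2.1 hu.2.2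
  exact ⟨A, B, h, h'⟩

theorem outside_le {V : Type*} [Fintype V] [DecidableEq V] (G : SimpleGraph V)
    [DecidableRel G.Adj] {A B : Finset V} {w : V}
    (h : (∀ a ∈ A, ∀ b ∈ A, G.Adj w a → G.Adj w b → a = b) ∧
      (∀ a ∈ B, ∀ b ∈ B, G.Adj w a → G.Adj w b → a = b)) :
    ((A ∪ B).filter (fun z => G.Adj w z)).card ≤ 2 := by
  rw [Finset.filter_union]
  refine (Finset.card_union_le _ _).trans ?_
  have h1 : (A.filter (fun z => G.Adj w z)).card ≤ 1 := by
    rw [Finset.card_le_one]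
    intro a ha b hb
    rw [Finset.mem_filter] at ha hb
    exact h.1 a ha.1 b hb.1 ha.2 hb.2
  have h2 : (B.filter (fun z => G.Adj w z)).card ≤ 1 := by
    rw [Finset.card_le_one]
    intro a ha b hb
    rw [Finset.mem_filter] at ha hb
    exact h.2 a ha.1 b hb.1 ha.2 hb.2
  omega

/-- a closed pair of size at least five misses at most two vertices -/
theorem size_bound {V : Type*} [Fintype V] [DecidableEq V] (G : SimpleGraph V)
    [DecidableRel G.Adj] (hn : 12 ≤ Fintype.card V)
    (hc : Gᶜ.edgeFinset.card ≤ Fintype.card V + 4) {S : Finset V} (hS : 5 ≤ S.card)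
    (h : ∀ w, w ∉ S → (S.filter (fun z => G.Adj w z)).card ≤ 2) :
    Sᶜ.card ≤ 2 := by
  by_contra hcon
  have hcut := cut_count G Sᶜ
  have hle : Sᶜ.card * (S.card - 2) ≤
      ∑ v ∈ Sᶜ, (Sᶜᶜ.filter (fun w => ¬ G.Adj v w)).card := by
    rw [← smul_eq_mul]
    refine Finset.card_nsmul_le_sum _ _ _ ?_
    intro v hv
    have h1 := Finset.card_filter_add_card_filter_not (s := S) (fun w => G.Adj v w)
    have h2 := h v (by simpa using hv)
    rw [compl_compl]
    omega
  have hsum := Finset.card_compl_add_card S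
  obtain ⟨k, hk⟩ : ∃ k, Sᶜ.card = k + 3 := ⟨Sᶜ.card - 3, by omega⟩
  obtain ⟨s, hs⟩ : ∃ s, S.card = s + 5 := ⟨S.card - 5, by omega⟩
  rw [hk, hs] at hle
  have : s + 5 - 2 = s + 3 := by omega
  rw [this] at hle
  have h5 : k * s ≥ 0 := Nat.zero_le _
  have h6 : (k + 3) * (s + 3) = k * s + 3 * k + 3 * s + 9 := by ring
  omega

theorem stmt14 {V : Type*} [Fintype V] (G : SimpleGraph V)
    (hn : 12 ≤ Fintype.card V) (h2c : TwoConnected G)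
    (hm : Nat.choose (Fintype.card V - 1) 2 - 5 ≤ G.edgeSet.ncard) :
    ∃ H : SimpleGraph V, H ≤ G ∧ TwoConnected H ∧
      ∃ s : Set V, ∀ a b : V, H.Adj a b → (a ∈ s ↔ b ∉ s) := by
  classical
  have hc := compl_count G hn hm
  have hdc : ∀ v, Gᶜ.degree v = Fintype.card V - 1 - G.degree v := fun v => G.degree_compl v
  by_cases hsmall : ∃ u, G.degree u ≤ 3
  · obtain ⟨u0, hu0⟩ := hsmall
    obtain ⟨u, -, hmin⟩ := Finset.exists_min_image Finset.univ (fun v => G.degree v)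
      ⟨u0, Finset.mem_univ _⟩
    have hu3 : G.degree u ≤ 3 := (hmin u0 (Finset.mem_univ _)).trans hu0
    obtain ⟨A0, B0, hg0, hu0, h50⟩ := small_start G hn hc u (deg_two G h2c u) hu3
    obtain ⟨A, B, hg, hsub, hcl⟩ := good_closure _ A0 B0 rfl hg0
    have h5 := h50.trans (Finset.card_le_card hsub)
    have huS := hsub hu0
    have hout : ∀ w, w ∉ A ∪ B → ((A ∪ B).filter (fun z => G.Adj w z)).card ≤ 2 :=
      fun w hw => outside_le G (hcl w hw)
    have hsz := size_bound G hn hc h5 hout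
    refine good_final (by omega) hg ?_
    generalize A ∪ B = S at *
    by_contra! hne
    obtain ⟨w, hw⟩ := hne
    have hod := out_deg G S w
    have hw2 := hout w hw
    have hwu : w ≠ u := by rintro rfl; exact hw huS
    by_cases hone : Sᶜ.card ≤ 1
    · have h0 : (Sᶜ.filter (fun z => G.Adj w z)).card = 0 := by
        rw [Finset.card_eq_zero, Finset.filter_eq_empty_iff]
        intro z hz hwz
        exact hwz.ne (Finset.card_le_one.1 hone w (by simpa using hw) z hz)
      have hp := pair_count G hwu
      have := hmin w (Finset.mem_univ _)
      rw [hdc, hdc] at hp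
      omega
    · obtain ⟨w1, w2, hww, hSc⟩ := Finset.card_eq_two.1 (show Sᶜ.card = 2 by omega)
      have m1 : w1 ∉ S := by rw [← Finset.mem_compl, hSc]; simp
      have m2 : w2 ∉ S := by rw [← Finset.mem_compl, hSc]; simp
      have n1 : w1 ≠ u := by rintro rfl; exact m1 huS
      have n2 : w2 ≠ u := by rintro rfl; exact m2 huS
      have hcut := cut_count G {w1, w2, u}
      rw [Finset.sum_insert (by simp [hww, n1]), Finset.sum_pair n2] at hcut
      have hcard : ({w1, w2, u} : Finset V).card = 3 := Finset.card_eq_three.2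
        ⟨_, _, _, hww, n1, n2, rfl⟩
      have l1 := out_lower G {w1, w2, u} w1
      have l2 := out_lower G {w1, w2, u} w2
      have l3 := out_lower G {w1, w2, u} u
      have d3 := out_deg G {w1, w2, u} u
      have hmono : ∀ v, ((({w1, w2, u} : Finset V)ᶜ).filter (fun z => G.Adj v z)).card ≤
          (S.filter (fun z => G.Adj v z)).card := by
        intro v
        apply Finset.card_le_card
        apply Finset.filter_subset_filter
        intro z hz
        by_contra hzS
        rw [← Finset.mem_compl, hSc] at hzS
        simp at hz hzS
        tauto
      have k1 := (hmono w1).trans (hout w1 m1)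
      have k2 := (hmono w2).trans (hout w2 m2)
      omega
  · push Not at hsmall
    obtain ⟨A0, B0, hg0, h50⟩ := big_start G hn hc
    obtain ⟨A, B, hg, hsub, hcl⟩ := good_closure _ A0 B0 rfl hg0
    have h5 := h50.trans (Finset.card_le_card hsub)
    have hout : ∀ w, w ∉ A ∪ B → ((A ∪ B).filter (fun z => G.Adj w z)).card ≤ 2 :=
      fun w hw => outside_le G (hcl w hw)
    have hsz := size_bound G hn hc h5 hout
    refine good_final (by omega) hg ?_
    generalize A ∪ B = S at *
    by_contra! hne
    obtain ⟨w, hw⟩ := hne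
    have hod := out_deg G S w
    have hw2 := hout w hw
    have h1 : (Sᶜ.filter (fun z => G.Adj w z)).card < Sᶜ.card := by
      apply Finset.card_lt_card
      rw [Finset.filter_ssubset]
      exact ⟨w, by simpa using hw, G.irrefl⟩
    have := hsmall w
    omega
end

section
/- Let G be a connected graph of order n ≥ 14. If C(n−3, 2) + 4 ≤ |E(G)| ≤ C(n, 2) − 1, then pc(G) = 2. -/
section aux

variable {V : Type*}

def PP (G : SimpleGraph V) (c : Sym2 V → Bool) (H : Finset V) (u w : V) (α β : Bool) : Prop :=
  ∃ p : G.Walk u w, p.IsPath ∧ (∀ z ∈ p.support, z ∈ H) ∧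
    (p.edges.map c).IsChain (· ≠ ·) ∧ (p.edges.map c).head? = some α ∧
    (p.edges.map c).getLast? = some β

theorem PP.single {G : SimpleGraph V} {c : Sym2 V → Bool} {H : Finset V} {u w : V}
    (h : G.Adj u w) (hu : u ∈ H) (hw : w ∈ H) {α β : Bool} (hα : c s(u, w) = α)
    (hβ : c s(u, w) = β) :
    PP G c H u w α β := by
  refine ⟨SimpleGraph.Walk.cons h .nil, ?_, ?_, ?_, ?_, ?_⟩
  · simp [h.ne]
  · simp [hu, hw]
  · simp
  · simp [hα]
  · simp [hβ]

theorem PP.symm {G : SimpleGraph V} {c : Sym2 V → Bool} {H : Finset V} {u w : V} {α β : Bool}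
    (h : PP G c H u w α β) : PP G c H w u β α := by
  obtain ⟨p, h1, h2, h3, h4, h5⟩ := h
  refine ⟨p.reverse, h1.reverse, ?_, ?_, ?_, ?_⟩
  · simpa using h2
  · rw [SimpleGraph.Walk.edges_reverse, List.map_reverse, List.isChain_reverse]
    exact h3.imp (fun a b hab => hab.symm)
  · simpa using h5
  · simpa using h4

theorem PP.mono {G : SimpleGraph V} {c c' : Sym2 V → Bool} {H H' : Finset V} {u w : V}
    {α β : Bool} (h : PP G c H u w α β) (hH : H ⊆ H')
    (hc : ∀ x ∈ H, ∀ y ∈ H, c' s(x, y) = c s(x, y)) : PP G c' H' u w α β := by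
  obtain ⟨p, h1, h2, h3, h4, h5⟩ := h
  have : p.edges.map c' = p.edges.map c := by
    apply List.map_congr_left
    intro e he
    induction e with
    | h x y =>
      exact hc _ (h2 _ (p.fst_mem_support_of_mem_edges he)) _
        (h2 _ (p.snd_mem_support_of_mem_edges he))
  refine ⟨p, h1, fun z hz => hH (h2 z hz), ?_, ?_, ?_⟩ <;> rw [this] <;> assumption

theorem PP.cons [DecidableEq V] {G : SimpleGraph V} {c : Sym2 V → Bool} {H : Finset V} {v u w : V}
    {α β γ : Bool} (h : PP G c H u w α β) (hv : v ∉ H) (ha : G.Adj v u)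
    (hγ : c s(v, u) = γ) (hne : γ ≠ α) : PP G c (insert v H) v w γ β := by
  obtain ⟨p, h1, h2, h3, h4, h5⟩ := h
  refine ⟨SimpleGraph.Walk.cons ha p, ?_, ?_, ?_, ?_, ?_⟩
  · rw [SimpleGraph.Walk.cons_isPath_iff]
    exact ⟨h1, fun hh => hv (h2 _ hh)⟩
  · intro z hz
    rw [SimpleGraph.Walk.support_cons, List.mem_cons] at hz
    rcases hz with rfl | hz
    · simp
    · simp [h2 z hz]
  · rw [SimpleGraph.Walk.edges_cons, List.map_cons, List.isChain_cons]
    refine ⟨?_, h3⟩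
    intro y hy
    rw [h4] at hy
    simp at hy
    subst hy
    rw [hγ]; exact hne
  · simp [hγ]
  · rw [SimpleGraph.Walk.edges_cons, List.map_cons, List.getLast?_cons, h5]
    simp

/-- strong core -/
def Core (G : SimpleGraph V) (c : Sym2 V → Bool) (H : Finset V) (κ : V → Bool) : Prop :=
  ∀ u ∈ H, ∀ w ∈ H, u ≠ w → ∀ d : Bool, PP G c H u w (xor (κ u) d) (!(xor (κ w) d))

theorem upd_agree [DecidableEq V] {c : Sym2 V → Bool} {H : Finset V} {v a : V} {γ : Bool}
    (hv : v ∉ H) : ∀ x ∈ H, ∀ y ∈ H, Function.update c s(v, a) γ s(x, y) = c s(x, y) := by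
  intro x hx y hy
  apply Function.update_of_ne
  intro h
  rw [Sym2.eq_iff] at h
  rcases h with ⟨rfl, _⟩ | ⟨_, rfl⟩ <;> exact hv (by assumption)

theorem Core.add [DecidableEq V] {G : SimpleGraph V} {c : Sym2 V → Bool} {H : Finset V}
    {κ : V → Bool} (h : Core G c H κ) {v x y : V} (hv : v ∉ H) (hx : x ∈ H) (hy : y ∈ H)
    (hxy : x ≠ y) (hκ : κ x = κ y) (ax : G.Adj v x) (ay : G.Adj v y) :
    ∃ c', Core G c' (insert v H) (Function.update κ v (!(κ x))) := by
  have hag : ∀ p ∈ H, ∀ q ∈ H, Function.update (Function.update c s(v, x) (!(κ x))) s(v, y) (κ x)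
      s(p, q) = c s(p, q) := by
    intro p hp q hq
    rw [upd_agree hv p hp q hq, upd_agree hv p hp q hq]
  refine ⟨Function.update (Function.update c s(v, x) (!(κ x))) s(v, y) (κ x), ?_⟩
  set c' := Function.update (Function.update c s(v, x) (!(κ x))) s(v, y) (κ x) with hc'
  have e2 : c' s(v, y) = κ x := by simp [hc']
  have e1 : c' s(v, x) = !(κ x) := by
    rw [hc', Function.update_of_ne, Function.update_self]
    intro hh
    rw [Sym2.eq_iff] at hh
    rcases hh with ⟨_, h2⟩ | ⟨h1, h2⟩
    · exact hxy h2
    · exact hv (h1 ▸ hy)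
  have key : ∀ w ∈ H, ∀ d : Bool, PP G c' (insert v H) v w (xor (!(κ x)) d) (!(xor (κ w) d)) := by
    intro w hw d
    cases d with
    | false =>
      by_cases hwx : w = x
      · subst hwx
        apply PP.single ax (by simp) (by simp [hw]) <;> simp [e1]
      · have := (h x hx w hw (Ne.symm hwx) false).mono (H' := H) (c' := c') (by simp) hag
        refine this.cons hv ax ?_ ?_ <;> simp [e1]
    | true =>
      by_cases hwx : w = y
      · subst hwx
        apply PP.single ay (by simp) (by simp [hw]) <;> simp [e2, hκ]
      · have := (h y hy w hw (Ne.symm hwx) true).mono (H' := H) (c' := c') (by simp) hag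
        refine this.cons hv ay ?_ ?_ <;> simp [e2, hκ]
  intro u hu w hw huw d
  rw [Finset.mem_insert] at hu hw
  rcases hu with rfl | hu
  · rcases hw with rfl | hw
    · exact absurd rfl huw
    · have hwu : w ≠ u := fun h => huw h.symm
      simpa [Function.update_of_ne hwu] using key w hw d
  · have huv : u ≠ v := fun h => hv (h ▸ hu)
    rcases hw with rfl | hw
    · have := (key u hu (!d)).symm
      simpa [Function.update_of_ne huv] using this
    · have hwv : w ≠ v := fun h => hv (h ▸ hw)
      simpa [Function.update_of_ne huv, Function.update_of_ne hwv] using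
        (h u hu w hw huw d).mono (H' := insert v H) (c' := c') (by simp) hag

theorem four_aux [DecidableEq V] {G : SimpleGraph V} {c : Sym2 V → Bool} {H : Finset V}
    {x p y q : V} {α : Bool} (hH : H = {x, p, y, q})
    (h1 : x ≠ p) (h2 : x ≠ y) (h3 : x ≠ q) (h4 : p ≠ y) (h5 : p ≠ q) (h6 : y ≠ q)
    (a1 : G.Adj x p) (a2 : G.Adj p y) (a3 : G.Adj y q) (a4 : G.Adj q x)
    (e1 : c s(x, p) = α) (e2 : c s(p, y) = !α) (e3 : c s(y, q) = α) (e4 : c s(q, x) = !α) :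
    PP G c H x p α α ∧ PP G c H x p (!α) (!α) ∧ PP G c H x y α (!α) ∧ PP G c H x y (!α) α ∧
    PP G c H x q α α ∧ PP G c H x q (!α) (!α) := by
  subst hH
  have e4' : c s(x, q) = !α := by rw [Sym2.eq_swap]; exact e4
  have e3' : c s(q, y) = α := by rw [Sym2.eq_swap]; exact e3
  have e2' : c s(y, p) = !α := by rw [Sym2.eq_swap]; exact e2
  have n1 : α ≠ !α := by cases α <;> simp
  have n2 : (!α) ≠ α := by cases α <;> simp
  have P1 : PP G c {y, p} y p (!α) (!α) := PP.single a2.symm (by simp) (by simp) e2' e2'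
  have P2 : PP G c (insert q {y, p}) q p α (!α) :=
    P1.cons (by simp [h6.symm, h5.symm]) a3.symm e3' n1
  have P3 : PP G c (insert x (insert q {y, p})) x p (!α) (!α) :=
    P2.cons (by simp [h1, h2, h3]) a4.symm e4' n2
  have Q1 : PP G c {y, q} y q α α := PP.single a3 (by simp) (by simp) e3 e3
  have Q2 : PP G c (insert p {y, q}) p q (!α) α :=
    Q1.cons (by simp [h4, h5]) a2 e2 n2
  have Q3 : PP G c (insert x (insert p {y, q})) x q α α :=
    Q2.cons (by simp [h1, h2, h3]) a1 e1 n1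
  have R1 : PP G c {p, y} p y (!α) (!α) := PP.single a2 (by simp) (by simp) e2 e2
  have R2 : PP G c (insert x {p, y}) x y α (!α) := R1.cons (by simp [h1, h2]) a1 e1 n1
  have S1 : PP G c {q, y} q y α α := PP.single a3.symm (by simp) (by simp) e3' e3'
  have S2 : PP G c (insert x {q, y}) x y (!α) α := S1.cons (by simp [h3, h2]) a4.symm e4' n2
  have ss : ∀ A : Finset V, (∀ z ∈ A, z = x ∨ z = p ∨ z = y ∨ z = q) →
    A ⊆ ({x, p, y, q} : Finset V) := by
    intro A hA z hz
    simpa using hA z hz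
  refine ⟨PP.single a1 (by simp) (by simp) e1 e1, P3.mono (ss _ ?_) (by simp),
    R2.mono (ss _ ?_) (by simp), S2.mono (ss _ ?_) (by simp),
    Q3.mono (ss _ ?_) (by simp), PP.single a4.symm (by simp) (by simp) e4' e4'⟩ <;>
  · intro z hz
    simp only [Finset.mem_insert, Finset.mem_singleton] at hz
    tauto

theorem four [DecidableEq V] {G : SimpleGraph V} {x p y q : V}
    (h1 : x ≠ p) (h2 : x ≠ y) (h3 : x ≠ q) (h4 : p ≠ y) (h5 : p ≠ q) (h6 : y ≠ q)
    (a1 : G.Adj x p) (a2 : G.Adj p y) (a3 : G.Adj y q) (a4 : G.Adj q x) :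
    ∃ c κ, Core G c {x, p, y, q} κ ∧ κ x = κ y := by
  let c : Sym2 V → Bool := fun e => decide (e = s(p, y) ∨ e = s(q, x))
  let κ : V → Bool := fun v => decide (v = p ∨ v = q)
  have e1 : c s(x, p) = false := by simp [c, h1, h2, h3, h4, h5]
  have e2 : c s(p, y) = true := by simp [c]
  have e3 : c s(y, q) = false := by
    simp [c, h6, h2.symm, h3.symm, h4.symm, h5.symm, h6.symm]
  have e4 : c s(q, x) = true := by simp [c]
  have k1 : κ x = false := by simp [κ, h1, h3]
  have k2 : κ p = true := by simp [κ]
  have k3 : κ y = false := by simp [κ, h4.symm, h6]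
  have k4 : κ q = true := by simp [κ]
  refine ⟨c, κ, ?_, by rw [k1, k3]⟩
  have A := four_aux (c := c) rfl h1 h2 h3 h4 h5 h6 a1 a2 a3 a4 e1 e2 e3 e4
  have B := four_aux (c := c) (H := {x, p, y, q}) (x := p) (p := y) (y := q) (q := x)
    (by ext; simp; tauto) h4 h5 h1.symm h6 h2.symm h3.symm a2 a3 a4 a1 e2 e3 e4 e1
  have C := four_aux (c := c) (H := {x, p, y, q}) (x := y) (p := q) (y := x) (q := p)
    (by ext; simp; tauto) h6 h2.symm h4.symm h3.symm h5.symm h1 a3 a4 a1 a2 e3 e4 e1 e2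
  have D := four_aux (c := c) (H := {x, p, y, q}) (x := q) (p := x) (y := p) (q := y)
    (by ext; simp; tauto) h3.symm h5.symm h6.symm h1 h2 h4 a4 a1 a2 a3 e4 e1 e2 e3
  simp only [Bool.not_true, Bool.not_false] at A B C D
  intro u hu w hw huw d
  simp only [Finset.mem_insert, Finset.mem_singleton] at hu hw
  rcases hu with rfl | rfl | rfl | rfl <;> rcases hw with rfl | rfl | rfl | rfl <;> cases d <;>
    first
    | exact absurd rfl huw
    | (simp only [k1, k2, k3, k4, Bool.xor_true, Bool.xor_false, Bool.not_true, Bool.not_false]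
       tauto)

/-- proper connectedness inside a set -/
def PC (G : SimpleGraph V) (c : Sym2 V → Bool) (S : Finset V) : Prop :=
  ∀ u ∈ S, ∀ w ∈ S, u ≠ w → ∃ α β, PP G c S u w α β

def From (G : SimpleGraph V) (c : Sym2 V → Bool) (S : Finset V) (a : V) (γ : Bool) : Prop :=
  a ∈ S ∧ ∀ w ∈ S, w ≠ a → ∃ β, PP G c S a w γ β

theorem Core.pc {G : SimpleGraph V} {c : Sym2 V → Bool} {H : Finset V}
    {κ : V → Bool} (h : Core G c H κ) : PC G c H :=
  fun u hu w hw huw => ⟨_, _, h u hu w hw huw false⟩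

theorem Core.ffrom {G : SimpleGraph V} {c : Sym2 V → Bool} {H : Finset V}
    {κ : V → Bool} (h : Core G c H κ) {a : V} (ha : a ∈ H) (γ : Bool) : From G c H a γ := by
  refine ⟨ha, fun w hw hwa => ?_⟩
  have := h a ha w hw hwa.symm (xor (κ a) γ)
  rw [← Bool.xor_assoc, Bool.xor_self, Bool.false_xor] at this
  exact ⟨_, this⟩

theorem pendant [DecidableEq V] {G : SimpleGraph V} {c : Sym2 V → Bool} {S : Finset V} {a v : V}
    {γ : Bool} (h : PC G c S) (hf : From G c S a γ) (hv : v ∉ S) (hav : G.Adj v a) :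
    PC G (Function.update c s(v, a) (!γ)) (insert v S) ∧
    From G (Function.update c s(v, a) (!γ)) (insert v S) v (!γ) := by
  have hag := upd_agree (c := c) (a := a) (γ := !γ) hv
  set c' := Function.update c s(v, a) (!γ) with hc'
  have e : c' s(v, a) = !γ := by simp [hc']
  have key : From G c' (insert v S) v (!γ) := by
    refine ⟨by simp, fun w hw hwv => ?_⟩
    have hw : w ∈ S := by simpa [hwv] using hw
    by_cases hwa : w = a
    · subst hwa
      exact ⟨!γ, PP.single hav (by simp) (by simp [hw]) e e⟩
    · obtain ⟨β, hβ⟩ := hf.2 w hw hwa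
      exact ⟨β, (hβ.mono (H' := S) (c' := c') (by simp) hag).cons hv hav e (by simp)⟩
  refine ⟨?_, key⟩
  intro u hu w hw huw
  by_cases huv : u = v
  · subst huv
    exact ⟨_, key.2 w hw huw.symm⟩
  · by_cases hwv : w = v
    · subst hwv
      obtain ⟨β, hβ⟩ := key.2 u hu huw
      exact ⟨_, _, hβ.symm⟩
    · obtain ⟨α, β, hh⟩ := h u (by simpa [huv] using hu) w (by simpa [hwv] using hw) huw
      exact ⟨α, β, hh.mono (by simp) hag⟩

theorem two [DecidableEq V] {G : SimpleGraph V} {c : Sym2 V → Bool} {H : Finset V}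
    {κ : V → Bool} (h : Core G c H κ) {a b x y : V} (ha : a ∉ H) (hb : b ∉ H) (hab : a ≠ b)
    (hx : x ∈ H) (hy : y ∈ H) (ax : G.Adj a x) (ay : G.Adj b y) :
    ∃ c' γ, PC G c' (insert a (insert b H)) ∧ From G c' (insert a (insert b H)) a γ := by
  obtain ⟨hp, hf⟩ := pendant h.pc (h.ffrom hy true) hb ay
  have hag := upd_agree (c := c) (a := y) (γ := !true) hb
  set c' := Function.update c s(b, y) (!true) with hc'
  have : ∃ δ, From G c' (insert b H) x δ := by
    obtain ⟨β, hβ⟩ := hf.2 x (by simp [hx]) (fun e => hb (e ▸ hx))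
    refine ⟨β, by simp [hx], fun w hw hwx => ?_⟩
    rw [Finset.mem_insert] at hw
    rcases hw with rfl | hw
    · exact ⟨_, hβ.symm⟩
    · obtain ⟨β', h'⟩ := (h.ffrom hx β).2 w hw hwx
      exact ⟨β', h'.mono (by simp) hag⟩
  obtain ⟨δ, hδ⟩ := this
  exact ⟨_, _, pendant hp hδ (by simp [ha, hab]) ax⟩

theorem star [DecidableEq V] {G : SimpleGraph V} {c : Sym2 V → Bool} {H : Finset V}
    {κ : V → Bool} (h : Core G c H κ) {a b d x y : V} (ha : a ∉ H) (hb : b ∉ H) (hd : d ∉ H)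
    (hab : a ≠ b) (had : a ≠ d) (hbd : b ≠ d)
    (hx : x ∈ H) (hy : y ∈ H) (hxy : x ≠ y) (ax : G.Adj a x) (ay : G.Adj a y)
    (ab : G.Adj b a) (ad : G.Adj d a) :
    ∃ c', PC G c' (insert d (insert b (insert a H))) := by
  obtain ⟨hp, hf⟩ := pendant h.pc (h.ffrom hx true) ha ax
  have hag1 := upd_agree (c := c) (a := x) (γ := !true) ha
  set c1 := Function.update c s(a, x) (!true) with hc1
  have hag : ∀ p ∈ H, ∀ q ∈ H, Function.update c1 s(a, y) true s(p, q) = c s(p, q) := by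
    intro p hp q hq
    rw [upd_agree ha p hp q hq, hag1 p hp q hq]
  set c2 := Function.update c1 s(a, y) true with hc2
  have e2 : c2 s(a, y) = true := by simp [hc2]
  have e1 : c2 s(a, x) = false := by
    rw [hc2, Function.update_of_ne, hc1, Function.update_self]
    · rfl
    intro hh
    rw [Sym2.eq_iff] at hh
    rcases hh with ⟨_, h2⟩ | ⟨h1, h2⟩
    · exact hxy h2
    · exact ha (h1 ▸ hy)
  have F1 : ∀ (z : V) (γ : Bool), z ∈ H → G.Adj a z → c2 s(a, z) = γ →
      From G c2 (insert a H) a γ := by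
    intro z γ hz az hγ
    refine ⟨by simp, fun w hw hwa => ?_⟩
    have hw : w ∈ H := by simpa [hwa] using hw
    by_cases hwz : w = z
    · subst hwz
      exact ⟨_, PP.single az (by simp) (by simp [hw]) hγ rfl⟩
    · obtain ⟨β, hβ⟩ := (h.ffrom hz (!γ)).2 w hw hwz
      exact ⟨β, (hβ.mono (H' := H) (c' := c2) (by simp) hag).cons ha az hγ (by simp)⟩
  have Ff := F1 x false hx ax e1
  have Ft := F1 y true hy ay e2
  have P2 : PC G c2 (insert a H) := by
    intro u hu w hw huw
    by_cases hua : u = a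
    · subst hua
      exact ⟨_, Ff.2 w hw huw.symm⟩
    · by_cases hwa : w = a
      · subst hwa
        obtain ⟨β, hβ⟩ := Ff.2 u hu huw
        exact ⟨_, _, hβ.symm⟩
      · obtain ⟨α, β, hh⟩ := h.pc u (by simpa [hua] using hu) w (by simpa [hwa] using hw) huw
        exact ⟨α, β, hh.mono (by simp) hag⟩
  have hbS : b ∉ insert a H := by simp [hb, hab.symm]
  obtain ⟨P3, F3⟩ := pendant P2 Ff hbS ab
  have hag3 := upd_agree (c := c2) (a := a) (γ := !false) hbS
  set c3 := Function.update c2 s(b, a) (!false) with hc3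
  have F4 : From G c3 (insert b (insert a H)) a true := by
    refine ⟨by simp, fun w hw hwa => ?_⟩
    by_cases hwb : w = b
    · subst hwb
      have : c3 s(a, w) = true := by rw [Sym2.eq_swap, hc3, Function.update_self]; rfl
      exact ⟨_, PP.single ab.symm (by simp) (by simp) this rfl⟩
    · obtain ⟨β, hβ⟩ := Ft.2 w (by simpa [hwb] using hw) hwa
      exact ⟨β, hβ.mono (by simp) hag3⟩
  exact ⟨_, (pendant P3 F4 (by simp [hd, had.symm, hbd.symm]) ad).1⟩

theorem fin1 [DecidableEq V] [Fintype V] {G : SimpleGraph V} {c : Sym2 V → Bool} {H : Finset V}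
    {κ : V → Bool} (h : Core G c H κ) (P N : V → Prop) (f g : V → V)
    (hP : ∀ v, v ∉ H → P v → f v ∈ H ∧ G.Adj v (f v))
    (hN : ∀ v, v ∉ H → N v → g v ∈ H ∧ G.Adj v (g v))
    (hPN : ∀ v, v ∉ H → P v → N v → f v ≠ g v)
    (hor : ∀ v, v ∉ H → P v ∨ N v)
    (hpair : ∀ u v, u ∉ H → v ∉ H → u ≠ v → (P u ∧ N v) ∨ (N u ∧ P v) ∨ G.Adj u v) :
    ∃ c', PC G c' Finset.univ := by
  classical
  let c' : Sym2 V → Bool := fun e => if ∀ z ∈ e, z ∈ H then c e else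
    decide (∃ v, v ∉ H ∧ ((P v ∧ e = s(v, f v) ∧ κ (f v) = false) ∨
      (N v ∧ e = s(v, g v) ∧ κ (g v) = true)))
  have hag : ∀ p ∈ H, ∀ q ∈ H, c' s(p, q) = c s(p, q) := by
    intro p hp q hq
    simp [c', hp, hq]
  have inj : ∀ v v' x x' : V, v ∉ H → v' ∉ H → x ∈ H → x' ∈ H → s(v, x) = s(v', x') →
      v = v' ∧ x = x' := by
    intro v v' x x' hv hv' hx hx' hh
    rw [Sym2.eq_iff] at hh
    rcases hh with hh | ⟨h1, h2⟩
    · exact hh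
    · exact absurd (h1 ▸ hx') hv
  have eP : ∀ v, v ∉ H → P v → c' s(v, f v) = !(κ (f v)) := by
    intro v hv hp
    have h1 : ¬ ∀ z ∈ s(v, f v), z ∈ H := fun hh => hv (hh v (by simp))
    simp only [c', if_neg h1]
    cases hk : κ (f v) with
    | false => exact decide_eq_true ⟨v, hv, Or.inl ⟨hp, rfl, hk⟩⟩
    | true =>
      simp only [Bool.not_true, decide_eq_false_iff_not]
      rintro ⟨w, hw, ⟨hpw, he, hkw⟩ | ⟨hpw, he, hkw⟩⟩
      · obtain ⟨rfl, h2⟩ := inj _ _ _ _ hv hw (hP v hv hp).1 (hP w hw hpw).1 he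
        simp [hk] at hkw
      · obtain ⟨rfl, h2⟩ := inj _ _ _ _ hv hw (hP v hv hp).1 (hN w hw hpw).1 he
        exact hPN v hv hp hpw h2
  have eN : ∀ v, v ∉ H → N v → c' s(v, g v) = κ (g v) := by
    intro v hv hp
    have h1 : ¬ ∀ z ∈ s(v, g v), z ∈ H := fun hh => hv (hh v (by simp))
    simp only [c', if_neg h1]
    cases hk : κ (g v) with
    | true => exact decide_eq_true ⟨v, hv, Or.inr ⟨hp, rfl, hk⟩⟩
    | false =>
      simp only [decide_eq_false_iff_not]
      rintro ⟨w, hw, ⟨hpw, he, hkw⟩ | ⟨hpw, he, hkw⟩⟩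
      · obtain ⟨rfl, h2⟩ := inj _ _ _ _ hv hw (hN v hv hp).1 (hP w hw hpw).1 he
        exact hPN v hv hpw hp h2.symm
      · obtain ⟨rfl, h2⟩ := inj _ _ _ _ hv hw (hN v hv hp).1 (hN w hw hpw).1 he
        simp [hk] at hkw
  have hc0 : Core G c' H κ := fun u hu w hw huw d => (h u hu w hw huw d).mono (by simp) hag
  have uni : ∀ {S u w α β}, PP G c' S u w α β → PP G c' Finset.univ u w α β :=
    fun hh => hh.mono (by simp) (by simp)
  have toH : ∀ u, u ∉ H → ∀ w ∈ H, ∃ α β, PP G c' Finset.univ u w α β := by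
    intro u hu w hw
    have aux : ∀ x ∈ H, G.Adj u x → ∃ α β, PP G c' Finset.univ u w α β := by
      intro x hx hux
      by_cases hwx : w = x
      · subst hwx
        exact ⟨_, _, PP.single hux (by simp) (by simp) rfl rfl⟩
      · obtain ⟨β, hβ⟩ := (hc0.ffrom hx (!(c' s(u, x)))).2 w hw hwx
        exact ⟨_, _, uni (hβ.cons hu hux rfl (by simp))⟩
    rcases hor u hu with hp | hp
    · exact aux _ (hP u hu hp).1 (hP u hu hp).2
    · exact aux _ (hN u hu hp).1 (hN u hu hp).2
  have cross : ∀ u v, u ∉ H → v ∉ H → u ≠ v → P u → N v → ∃ α β, PP G c' Finset.univ u v α β := by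
    intro u v hu hv huv hp hn
    obtain ⟨fx, fa⟩ := hP u hu hp
    obtain ⟨gx, ga⟩ := hN v hv hn
    have e1 := eP u hu hp
    have e2 := eN v hv hn
    by_cases hfg : f u = g v
    · have Q : PP G c' {g v, v} (g v) v (κ (g v)) (κ (g v)) := by
        have e3 : c' s(g v, v) = κ (g v) := by rw [Sym2.eq_swap]; exact e2
        exact PP.single ga.symm (by simp) (by simp) e3 e3
      have hug : u ≠ g v := fun e => hu (e ▸ gx)
      have Q2 := Q.cons (v := u) (by simp [huv, hug]) (hfg ▸ fa) (hfg ▸ e1) (by simp)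
      exact ⟨_, _, uni Q2⟩
    · have Q := (hc0 (f u) fx (g v) gx hfg false).cons hu fa e1 (by simp)
      have Q2 := Q.symm.cons (v := v) (by simp [hv, huv.symm]) ga e2 (by simp)
      exact ⟨_, _, uni Q2.symm⟩
  refine ⟨c', ?_⟩
  intro u _ w _ huw
  by_cases hu : u ∈ H
  · by_cases hw : w ∈ H
    · exact ⟨_, _, uni (hc0 u hu w hw huw false)⟩
    · obtain ⟨α, β, hh⟩ := toH w hw u hu
      exact ⟨_, _, hh.symm⟩
  · by_cases hw : w ∈ H
    · exact toH u hu w hw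
    · rcases hpair u w hu hw huw with ⟨h1, h2⟩ | ⟨h1, h2⟩ | h1
      · exact cross u w hu hw huw h1 h2
      · obtain ⟨α, β, hh⟩ := cross w u hw hu huw.symm h2 h1
        exact ⟨_, _, hh.symm⟩
      · exact ⟨_, _, PP.single h1 (by simp) (by simp) rfl rfl⟩

theorem boundary {G : SimpleGraph V} (hc : G.Connected) (T : Set V) {a b : V} (ha : a ∈ T)
    (hb : b ∉ T) : ∃ u ∈ T, ∃ w, w ∉ T ∧ G.Adj u w := by
  obtain ⟨p⟩ := hc.preconnected a b
  obtain ⟨d, _, h1, h2⟩ := p.exists_boundary_dart T ha hb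
  exact ⟨d.fst, h1, d.snd, h2, d.adj⟩

section cases
variable [DecidableEq V] [Fintype V] {G : SimpleGraph V} {c : Sym2 V → Bool} {H : Finset V}
    {κ : V → Bool}

theorem PC.uni {c : Sym2 V → Bool} {S : Finset V} (h : PC G c S) (hS : ∀ v, v ∈ S) :
    ∃ c', PC G c' Finset.univ := by
  refine ⟨c, ?_⟩
  rwa [← Finset.eq_univ_iff_forall.2 hS]

theorem three_A1 (h : Core G c H κ) {a b d x y z t : V}
    (hR : ∀ v, v ∉ H ↔ v = a ∨ v = b ∨ v = d) (hab : a ≠ b) (had : a ≠ d) (hbd : b ≠ d)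
    (hx : x ∈ H) (hy : y ∈ H) (hz : z ∈ H) (ht : t ∈ H) (hxy : x ≠ y)
    (ax : G.Adj a x) (ay : G.Adj a y) (bz : G.Adj b z) (dt : G.Adj d t) :
    ∃ c', PC G c' Finset.univ := by
  apply fin1 h (fun v => v ≠ d) (fun v => v ≠ b) (fun v => if v = a then x else z)
    (fun v => if v = a then y else t)
  · intro v hv hp
    rcases (hR v).1 hv with rfl | rfl | rfl
    · simp [hx, ax]
    · simp [hab.symm, hz, bz]
    · exact absurd rfl hp
  · intro v hv hp
    rcases (hR v).1 hv with rfl | rfl | rfl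
    · simp [hy, ay]
    · exact absurd rfl hp
    · simp [had.symm, ht, dt]
  · intro v hv hp hn
    rcases (hR v).1 hv with rfl | rfl | rfl
    · simpa using hxy
    · exact absurd rfl hn
    · exact absurd rfl hp
  · intro v hv
    by_cases hvd : v = d
    · subst hvd; exact Or.inr hbd.symm
    · exact Or.inl hvd
  · intro u v hu hv huv
    rcases (hR u).1 hu with rfl | rfl | rfl <;> rcases (hR v).1 hv with rfl | rfl | rfl <;>
      first
      | exact absurd rfl huv
      | simp [hab, had, hbd, hab.symm, had.symm, hbd.symm]

theorem three_A2 (h : Core G c H κ) {a b d x y z : V}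
    (hR : ∀ v, v ∉ H ↔ v = a ∨ v = b ∨ v = d) (hab : a ≠ b) (had : a ≠ d) (hbd : b ≠ d)
    (hx : x ∈ H) (hy : y ∈ H) (hz : z ∈ H) (ab : G.Adj a b)
    (ax : G.Adj a x) (bz : G.Adj b y) (dt : G.Adj d z) :
    ∃ c', PC G c' Finset.univ := by
  apply fin1 h (fun v => v ≠ d) (fun v => v = d) (fun v => if v = a then x else y)
    (fun v => z)
  · intro v hv hp
    rcases (hR v).1 hv with rfl | rfl | rfl
    · simp [hx, ax]
    · simp [hab.symm, hy, bz]
    · exact absurd rfl hp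
  · intro v hv hp
    subst hp
    exact ⟨hz, dt⟩
  · intro v hv hp hn
    exact absurd hn hp
  · intro v hv
    exact (em _).symm
  · intro u v hu hv huv
    rcases (hR u).1 hu with rfl | rfl | rfl <;> rcases (hR v).1 hv with rfl | rfl | rfl <;>
      simp_all [ab.symm]

theorem three_B1 (h : Core G c H κ) {a b d x y : V}
    (hR : ∀ v, v ∉ H ↔ v = a ∨ v = b ∨ v = d) (hab : a ≠ b) (had : a ≠ d) (hbd : b ≠ d)
    (hx : x ∈ H) (hy : y ∈ H) (ax : G.Adj a x) (bz : G.Adj b y) (da : G.Adj d a) :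
    ∃ c', PC G c' Finset.univ := by
  obtain ⟨c', γ, h1, h2⟩ := two h ((hR a).2 (by simp)) ((hR b).2 (by simp)) hab hx hy ax bz
  have hd : d ∉ insert a (insert b H) := by simp [had.symm, hbd.symm, hR]
  have := (pendant h1 h2 hd da).1
  apply this.uni
  intro v
  have := hR v
  simp only [Finset.mem_insert]
  tauto

theorem three_C1 (h : Core G c H κ) {a b d x : V}
    (hR : ∀ v, v ∉ H ↔ v = a ∨ v = b ∨ v = d) (hab : a ≠ b) (had : a ≠ d) (hbd : b ≠ d)
    (hx : x ∈ H) (ax : G.Adj a x) (ba : G.Adj b a) (db : G.Adj d b) :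
    ∃ c', PC G c' Finset.univ := by
  obtain ⟨h1, h2⟩ := pendant h.pc (h.ffrom hx true) ((hR a).2 (by simp)) ax
  obtain ⟨h3, h4⟩ := pendant h1 h2 (v := b) (by simp [hab.symm, hR]) ba
  have := (pendant h3 h4 (v := d) (by simp [had.symm, hbd.symm, hR]) db).1
  apply this.uni
  intro v
  have := hR v
  simp only [Finset.mem_insert]
  tauto

theorem three_C2 (h : Core G c H κ) {a b d x : V}
    (hR : ∀ v, v ∉ H ↔ v = a ∨ v = b ∨ v = d) (hab : a ≠ b) (had : a ≠ d) (hbd : b ≠ d)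
    (hx : x ∈ H) (ax : G.Adj a x) (ba : G.Adj b a) (hd : ¬ ∃ x ∈ H, G.Adj d x)
    (hc : G.Connected)
    (E2 : ¬ G.Adj b d → ∃ x ∈ H, ∃ y ∈ H, x ≠ y ∧ G.Adj a x ∧ G.Adj a y) :
    ∃ c', PC G c' Finset.univ := by
  by_cases db : G.Adj d b
  · exact three_C1 h hR hab had hbd hx ax ba db
  · obtain ⟨u, hu, w, hw, huw⟩ := boundary hc {d} (a := d) (b := a) rfl had
    have hu : u = d := hu
    have hw : w ≠ d := hw
    subst hu
    have hwH : w ∉ H := fun hh => hd ⟨w, hh, huw⟩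
    rcases (hR w).1 hwH with rfl | rfl | rfl
    · obtain ⟨x, hx, y, hy, hxy, ax, ay⟩ := E2 (fun hh => db hh.symm)
      obtain ⟨c', hc'⟩ := star h ((hR w).2 (by simp)) ((hR b).2 (by simp)) ((hR u).2 (by simp))
        hab had hbd hx hy hxy ax ay ba huw
      refine ⟨c', ?_⟩
      convert hc'
      ext v
      have := hR v
      simp only [Finset.mem_univ, Finset.mem_insert]
      tauto
    · exact absurd huw db
    · exact absurd rfl hw

theorem three_C (h : Core G c H κ) {a b d x : V}
    (hR : ∀ v, v ∉ H ↔ v = a ∨ v = b ∨ v = d) (hab : a ≠ b) (had : a ≠ d) (hbd : b ≠ d)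
    (hx : x ∈ H) (ax : G.Adj a x) (hb : ¬ ∃ x ∈ H, G.Adj b x) (hd : ¬ ∃ x ∈ H, G.Adj d x)
    (hc : G.Connected)
    (E2 : ¬ G.Adj b d → ∃ x ∈ H, ∃ y ∈ H, x ≠ y ∧ G.Adj a x ∧ G.Adj a y) :
    ∃ c', PC G c' Finset.univ := by
  obtain ⟨u, hu, w, hw, huw⟩ := boundary hc {b, d} (a := b) (b := a) (by simp) (by simp [hab, had])
  have hwH : w ∉ H := by
    rcases hu with rfl | hu
    · exact fun hh => hb ⟨w, hh, huw⟩
    · have hu : u = d := hu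
      subst hu
      exact fun hh => hd ⟨w, hh, huw⟩
  have hwa : w = a := by
    rcases (hR w).1 hwH with rfl | rfl | rfl
    · rfl
    · simp at hw
    · simp at hw
  subst hwa
  rcases hu with rfl | hu
  · exact three_C2 h hR hab had hbd hx ax huw hd hc E2
  · have hu : u = d := hu
    subst hu
    exact three_C2 h (by intro v; rw [hR]; tauto) had hab hbd.symm hx ax huw hb hc
      (fun hh => E2 (fun h => hh h.symm))

theorem three_B (h : Core G c H κ) {a b d x y : V}
    (hR : ∀ v, v ∉ H ↔ v = a ∨ v = b ∨ v = d) (hab : a ≠ b) (had : a ≠ d) (hbd : b ≠ d)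
    (hx : x ∈ H) (hy : y ∈ H) (ax : G.Adj a x) (bz : G.Adj b y) (hd : ¬ ∃ x ∈ H, G.Adj d x)
    (hc : G.Connected) :
    ∃ c', PC G c' Finset.univ := by
  obtain ⟨u, hu, w, hw, huw⟩ := boundary hc {d} (a := d) (b := a) rfl had
  have hu : u = d := hu
  have hw : w ≠ d := hw
  subst hu
  have hwH : w ∉ H := fun hh => hd ⟨w, hh, huw⟩
  rcases (hR w).1 hwH with rfl | rfl | rfl
  · exact three_B1 h hR hab had hbd hx hy ax bz huw
  · exact three_B1 h (by intro v; rw [hR]; tauto) hab.symm hbd had hy hx bz ax huw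
  · exact absurd rfl hw

theorem three (h : Core G c H κ) {a b d : V} (hne : H.Nonempty)
    (hR : ∀ v, v ∉ H ↔ v = a ∨ v = b ∨ v = d) (hab : a ≠ b) (had : a ≠ d) (hbd : b ≠ d)
    (hc : G.Connected)
    (E2 : ∀ a b d, a ∉ H → b ∉ H → d ∉ H → a ≠ b → a ≠ d → b ≠ d →
      (¬ ∃ x ∈ H, G.Adj b x) → (¬ ∃ x ∈ H, G.Adj d x) → ¬ G.Adj b d →
      ∃ x ∈ H, ∃ y ∈ H, x ≠ y ∧ G.Adj a x ∧ G.Adj a y)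
    (E1 : (∃ v, v ∉ H ∧ ∃ x ∈ H, ∃ y ∈ H, x ≠ y ∧ G.Adj v x ∧ G.Adj v y) ∨
      G.Adj a b ∨ G.Adj a d ∨ G.Adj b d) :
    ∃ c', PC G c' Finset.univ := by
  have ha' := (hR a).2 (by simp)
  have hb' := (hR b).2 (by simp)
  have hd' := (hR d).2 (by simp)
  have R1 : ∀ v, v ∉ H ↔ v = a ∨ v = d ∨ v = b := by intro v; rw [hR]; tauto
  have R2 : ∀ v, v ∉ H ↔ v = b ∨ v = a ∨ v = d := by intro v; rw [hR]; tauto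
  have R3 : ∀ v, v ∉ H ↔ v = b ∨ v = d ∨ v = a := by intro v; rw [hR]; tauto
  have R4 : ∀ v, v ∉ H ↔ v = d ∨ v = a ∨ v = b := by intro v; rw [hR]; tauto
  by_cases ha : ∃ x ∈ H, G.Adj a x
  · obtain ⟨x, hx, ax⟩ := id ha
    by_cases hb : ∃ x ∈ H, G.Adj b x
    · obtain ⟨y, hy, ay⟩ := id hb
      by_cases hd : ∃ x ∈ H, G.Adj d x
      · obtain ⟨z, hz, az⟩ := id hd
        rcases E1 with ⟨v, hv, p, hp, q, hq, hpq, h1, h2⟩ | h1 | h1 | h1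
        · rcases (hR v).1 hv with rfl | rfl | rfl
          · exact three_A1 h hR hab had hbd hp hq hy hz hpq h1 h2 ay az
          · exact three_A1 h R2 hab.symm hbd had hp hq hx hz hpq h1 h2 ax az
          · exact three_A1 h R4 had.symm hbd.symm hab hp hq hx hy hpq h1 h2 ax ay
        · exact three_A2 h hR hab had hbd hx hy hz h1 ax ay az
        · exact three_A2 h R1 had hab hbd.symm hx hz hy h1 ax az ay
        · exact three_A2 h R3 hbd hab.symm had.symm hy hz hx h1 ay az ax
      · exact three_B h hR hab had hbd hx hy ax ay hd hc
    · by_cases hd : ∃ x ∈ H, G.Adj d x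
      · obtain ⟨z, hz, az⟩ := id hd
        exact three_B h R1 had hab hbd.symm hx hz ax az hb hc
      · exact three_C h hR hab had hbd hx ax hb hd hc
          (E2 a b d ha' hb' hd' hab had hbd hb hd)
  · by_cases hb : ∃ x ∈ H, G.Adj b x
    · obtain ⟨y, hy, ay⟩ := id hb
      by_cases hd : ∃ x ∈ H, G.Adj d x
      · obtain ⟨z, hz, az⟩ := id hd
        exact three_B h R3 hbd hab.symm had.symm hy hz ay az ha hc
      · exact three_C h R2 hab.symm hbd had hy ay ha hd hc
          (E2 b a d hb' ha' hd' hab.symm hbd had ha hd)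
    · by_cases hd : ∃ x ∈ H, G.Adj d x
      · obtain ⟨z, hz, az⟩ := id hd
        exact three_C h R4 had.symm hbd.symm hab hz az ha hb hc
          (E2 d a b hd' ha' hb' had.symm hbd.symm hab ha hb)
      · obtain ⟨w, hw⟩ := hne
        obtain ⟨u, hu, w, hw, huw⟩ := boundary hc {v | v ∉ H} (a := a) (b := w) ha' (by simpa)
        have hw : w ∈ H := by simpa using hw
        rcases (hR u).1 hu with rfl | rfl | rfl
        · exact absurd ⟨w, hw, huw⟩ ha
        · exact absurd ⟨w, hw, huw⟩ hb
        · exact absurd ⟨w, hw, huw⟩ hd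

theorem one' (h : Core G c H κ) {a : V} (hne : H.Nonempty)
    (hR : ∀ v, v ∉ H ↔ v = a) (hc : G.Connected) : ∃ c', PC G c' Finset.univ := by
  obtain ⟨w, hw⟩ := hne
  obtain ⟨u, hu, w, hw, huw⟩ := boundary hc {v | v ∉ H} (a := a) (b := w) ((hR a).2 rfl) (by simpa)
  have hw : w ∈ H := by simpa using hw
  have : u = a := (hR u).1 hu
  subst this
  have := (pendant h.pc (h.ffrom hw true) hu huw).1
  apply this.uni
  intro v
  have := hR v
  simp only [Finset.mem_insert]
  tauto

theorem two_C (h : Core G c H κ) {a b x : V}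
    (hR : ∀ v, v ∉ H ↔ v = a ∨ v = b) (hab : a ≠ b) (hc : G.Connected) (hx : x ∈ H)
    (ax : G.Adj a x) : ∃ c', PC G c' Finset.univ := by
  by_cases hb : ∃ x ∈ H, G.Adj b x
  · obtain ⟨y, hy, ay⟩ := hb
    obtain ⟨c', γ, h1, h2⟩ := two h ((hR a).2 (by simp)) ((hR b).2 (by simp)) hab hx hy ax ay
    refine ⟨c', ?_⟩
    convert h1
    ext v
    have := hR v
    simp only [Finset.mem_univ, Finset.mem_insert]
    tauto
  · obtain ⟨u, hu, w, hw, huw⟩ := boundary hc {b} (a := b) (b := a) rfl hab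
    have hu : u = b := hu
    have hw : w ≠ b := hw
    subst hu
    have hwH : w ∉ H := fun hh => hb ⟨w, hh, huw⟩
    have : w = a := by
      rcases (hR w).1 hwH with h | h
      · exact h
      · exact absurd h hw
    subst this
    obtain ⟨h1, h2⟩ := pendant h.pc (h.ffrom hx true) ((hR w).2 (by simp)) ax
    have := (pendant h1 h2 (v := u) (by simp [hab.symm, hR]) huw).1
    apply this.uni
    intro v
    have := hR v
    simp only [Finset.mem_insert]
    tauto

theorem two' (h : Core G c H κ) {a b : V} (hne : H.Nonempty)
    (hR : ∀ v, v ∉ H ↔ v = a ∨ v = b) (hab : a ≠ b) (hc : G.Connected) :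
    ∃ c', PC G c' Finset.univ := by
  obtain ⟨w, hw⟩ := hne
  obtain ⟨u, hu, w, hw, huw⟩ := boundary hc {v | v ∉ H} (a := a) (b := w)
    ((hR a).2 (by simp)) (by simpa)
  have hw : w ∈ H := by simpa using hw
  rcases (hR u).1 hu with rfl | rfl
  · exact two_C h hR hab hc hw huw
  · exact two_C h (by intro v; rw [hR]; tauto) hab.symm hc hw huw

end cases

theorem count [DecidableEq V] [Fintype V] (G : SimpleGraph V) [DecidableRel G.Adj] (H : Finset V)
    (F : Finset (Sym2 V)) (hF : ∀ e ∈ F, e ∈ Gᶜ.edgeFinset) (hF' : ∀ e ∈ F, ∀ z ∈ e, z ∉ H) :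
    ∑ v ∈ Hᶜ, (H.filter (fun w => ¬ G.Adj v w)).card + F.card + G.edgeFinset.card ≤
      (Fintype.card V).choose 2 := by
  rw [← Finset.card_sigma]
  set D := Hᶜ.sigma (fun v => H.filter (fun w => ¬ G.Adj v w)) with hD
  let φ : (Σ _ : V, V) → Sym2 V := fun p => s(p.1, p.2)
  have hmem : ∀ p ∈ D, p.1 ∉ H ∧ p.2 ∈ H ∧ ¬ G.Adj p.1 p.2 := by
    intro p hp
    simpa [hD] using hp
  have h1 : (D.image φ).card = D.card := by
    apply Finset.card_image_of_injOn
    rintro ⟨a, b⟩ hp ⟨a', b'⟩ hq hpq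
    obtain ⟨x1, x2, x3⟩ := hmem _ hp
    obtain ⟨y1, y2, y3⟩ := hmem _ hq
    simp only [φ, Sym2.eq_iff] at hpq
    simp only at x1 x2 y1 y2
    rcases hpq with ⟨rfl, rfl⟩ | ⟨rfl, rfl⟩
    · rfl
    · exact absurd y2 x1
  rw [← h1]
  have d1 : Disjoint (D.image φ) F := by
    rw [Finset.disjoint_left]
    intro e he heF
    obtain ⟨p, hp, rfl⟩ := Finset.mem_image.1 he
    exact hF' _ heF p.2 (by simp [φ]) (hmem p hp).2.1
  rw [← Finset.card_union_of_disjoint d1]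
  have d2 : Disjoint (D.image φ ∪ F) G.edgeFinset := by
    rw [Finset.disjoint_left]
    intro e he heG
    rcases Finset.mem_union.1 he with he | he
    · obtain ⟨p, hp, rfl⟩ := Finset.mem_image.1 he
      have := (hmem p hp).2.2
      simp [φ] at heG
      exact this heG
    · have := hF e he
      induction e with
      | h x y =>
        simp at this heG
        exact this.2 heG
  rw [← Finset.card_union_of_disjoint d2, ← SimpleGraph.card_edgeFinset_top_eq_card_choose_two]
  apply Finset.card_le_card
  intro e he
  rcases Finset.mem_union.1 he with he | he
  · rcases Finset.mem_union.1 he with he | he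
    · obtain ⟨p, hp, rfl⟩ := Finset.mem_image.1 he
      obtain ⟨x1, x2, _⟩ := hmem _ hp
      have : p.1 ≠ p.2 := fun h => x1 (h ▸ x2)
      simpa [φ] using this
    · have := hF e he
      induction e with
      | h x y =>
        simp at this
        simpa using this.1
  · induction e with
    | h x y =>
      simp at he
      simpa using he.ne

theorem exists_pair [DecidableEq V] [Fintype V] (G : SimpleGraph V) [DecidableRel G.Adj]
    (hn : 14 ≤ Fintype.card V)
    (hE : (Fintype.card V).choose 2 + 10 ≤ G.edgeFinset.card + 3 * Fintype.card V) :
    ∃ x y, x ≠ y ∧ 5 ≤ (Finset.univ.filter (fun v => G.Adj v x ∧ G.Adj v y)).card := by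
  by_contra hcon
  push Not at hcon
  set n := Fintype.card V with hndef
  have dc := Finset.sum_card_bipartiteAbove_eq_sum_card_bipartiteBelow
    (s := (Finset.univ : Finset V)) (t := (Finset.univ : Finset V).offDiag)
    (fun v (p : V × V) => G.Adj v p.1 ∧ G.Adj v p.2)
  have l : ∀ v : V, ((Finset.univ : Finset V).offDiag.bipartiteAbove
      (fun v (p : V × V) => G.Adj v p.1 ∧ G.Adj v p.2) v).card =
      G.degree v * G.degree v - G.degree v := by
    intro v
    rw [← SimpleGraph.card_neighborFinset_eq_degree, ← Finset.offDiag_card]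
    congr 1
    ext p
    simp [Finset.bipartiteAbove, Finset.mem_offDiag]
    tauto
  have r : ∑ p ∈ (Finset.univ : Finset V).offDiag, (Finset.bipartiteBelow
      (fun v (p : V × V) => G.Adj v p.1 ∧ G.Adj v p.2) Finset.univ p).card ≤ (n * n - n) * 4 := by
    rw [hndef, ← Finset.card_univ, ← Finset.offDiag_card]
    rw [← smul_eq_mul]
    apply Finset.sum_le_card_nsmul
    intro p hp
    have := hcon p.1 p.2 (by simpa using hp)
    simp only [Finset.bipartiteBelow]
    omega
  rw [← dc, Finset.sum_congr rfl (fun v _ => l v)] at r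
  have hs := G.sum_degrees_eq_twice_card_edges
  have key : ∀ v, (2 * ((n : ℤ) - 6) * G.degree v - (n - 6) * (n - 5) : ℤ) ≤
      ((G.degree v * G.degree v - G.degree v : ℕ) : ℤ) := by
    intro v
    rw [Nat.cast_sub (Nat.le_mul_self _)]
    push_cast
    have : ∀ t : ℤ, 0 ≤ t * (t - 1) := by
      intro t
      rcases le_or_gt t 0 with h | h
      · nlinarith
      · nlinarith
    have := this ((G.degree v : ℤ) - (n - 6))
    nlinarith
  have S := Finset.sum_le_sum (fun v (_ : v ∈ Finset.univ) => key v)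
  rw [Finset.sum_sub_distrib, ← Finset.mul_sum, ← Nat.cast_sum, ← Nat.cast_sum, hs] at S
  simp only [Finset.sum_const, Finset.card_univ, ← hndef, nsmul_eq_mul] at S
  have r' : ((∑ v, (G.degree v * G.degree v - G.degree v) : ℕ) : ℤ) ≤ (n * n - n) * 4 := by
    have := (Nat.cast_le (α := ℤ)).2 r
    rw [Nat.cast_mul, Nat.cast_sub (Nat.le_mul_self _)] at this
    exact_mod_cast this
  have ch : (n.choose 2 : ℤ) * 2 = n * (n - 1) := by
    have := Nat.choose_two_right n
    have h2 : n.choose 2 * 2 = n * (n - 1) := by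
      rw [this]; exact Nat.div_mul_cancel (Nat.even_mul_pred_self n).two_dvd
    have h3 := congrArg (Nat.cast (R := ℤ)) h2
    push_cast [Nat.cast_sub (show 1 ≤ n by omega)] at h3
    exact h3
  have hE' : (n.choose 2 : ℤ) + 10 ≤ G.edgeFinset.card + 3 * n := by exact_mod_cast hE
  have hn' : (14 : ℤ) ≤ n := by exact_mod_cast hn
  push_cast at S
  rw [Nat.cast_sum] at r'
  have e2 : (n * (n-1) + 20 - 6 * n : ℤ) ≤ 2 * G.edgeFinset.card := by linarith
  have := mul_le_mul_of_nonneg_left e2 (show (0:ℤ) ≤ 2 * (n - 6) by linarith)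
  have f : 2 * ((n:ℤ) - 6) * (n * (n-1) + 20 - 6 * n) - n * ((n-6) * (n-5)) ≤ (n * n - n) * 4 := by
    linarith
  obtain ⟨m, hm⟩ : ∃ m : ℤ, (n : ℤ) = m + 14 := ⟨n - 14, by ring⟩
  rw [hm] at f
  have hm0 : 0 ≤ m := by linarith
  have : 0 ≤ m * m * m := by positivity
  nlinarith [mul_nonneg hm0 hm0]

theorem pc_eq_two (G : SimpleGraph V) [Fintype V] [DecidableEq V]
    (h : ∃ c, PC G c Finset.univ) (hnc : ∃ u v, u ≠ v ∧ ¬ G.Adj u v) : pc G = 2 := by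
  obtain ⟨c, hc⟩ := h
  have mem : 2 ∈ {k | ∃ c : Sym2 V → ℕ, (∀ e ∈ G.edgeSet, c e < k) ∧ IsProperPathColoring G c} := by
    refine ⟨fun e => (c e).toNat, fun e _ => Bool.toNat_lt _, ?_⟩
    intro u v huv
    obtain ⟨α, β, p, h1, _, h3, _⟩ := hc u (by simp) v (by simp) huv
    refine ⟨p, h1, ?_⟩
    unfold ProperWalk
    rw [List.isChain_map] at h3
    refine List.IsChain.imp ?_ h3
    intro a b hab hh
    apply hab
    revert hh
    show (c a).toNat = (c b).toNat → c a = c b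
    generalize c a = s
    generalize c b = t
    cases s <;> cases t <;> simp
  apply le_antisymm
  · exact Nat.sInf_le mem
  · apply le_csInf ⟨2, mem⟩
    rintro k ⟨c', hk, hp⟩
    by_contra hlt
    obtain ⟨u, v, huv, hnadj⟩ := hnc
    obtain ⟨p, hpp, hpr⟩ := hp u v huv
    cases p with
    | nil => exact huv rfl
    | cons a p =>
      cases p with
      | nil => exact hnadj a
      | cons b p =>
        unfold ProperWalk at hpr
        simp only [SimpleGraph.Walk.edges_cons] at hpr
        have h0 := (List.isChain_cons_cons.1 hpr).1
        have h1 := hk _ ((SimpleGraph.mem_edgeSet G).2 a)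
        have h2 := hk _ ((SimpleGraph.mem_edgeSet G).2 b)
        omega

theorem exists_core [DecidableEq V] [Fintype V] (G : SimpleGraph V) [DecidableRel G.Adj]
    (x y : V) (hxy : x ≠ y)
    (h5 : 5 ≤ (Finset.univ.filter (fun v => G.Adj v x ∧ G.Adj v y)).card) :
    ∃ (H : Finset V) (c : Sym2 V → Bool) (κ : V → Bool), Core G c H κ ∧ 7 ≤ H.card ∧
      ∀ v, v ∉ H → (H.filter (fun w => G.Adj v w)).card ≤ 2 := by
  classical
  set W := Finset.univ.filter (fun v => G.Adj v x ∧ G.Adj v y) with hW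
  let 𝒮 : Finset (Finset V) := Finset.univ.filter (fun H => x ∈ H ∧ y ∈ H ∧
    ∃ c κ, Core G c H κ ∧ κ x = κ y)
  have hne : 𝒮.Nonempty := by
    obtain ⟨p, hp, q, hq, hpq⟩ := Finset.one_lt_card.1 (show 1 < W.card by omega)
    simp only [hW, Finset.mem_filter, Finset.mem_univ, true_and] at hp hq
    refine ⟨{x, p, y, q}, ?_⟩
    simp only [𝒮, Finset.mem_filter, Finset.mem_univ, true_and]
    exact ⟨by simp, by simp, four hp.1.ne.symm hxy hq.1.ne.symm hp.2.ne hpq hq.2.ne.symm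
      hp.1.symm hp.2 hq.2.symm hq.1⟩
  obtain ⟨H, hH, hmax⟩ := 𝒮.exists_max_image Finset.card hne
  simp only [𝒮, Finset.mem_filter, Finset.mem_univ, true_and] at hH hmax
  obtain ⟨hx, hy, c, κ, hcore, hκ⟩ := hH
  have ext : ∀ v, v ∉ H → ∀ p ∈ H, ∀ q ∈ H, p ≠ q → G.Adj v p → G.Adj v q → κ p ≠ κ q := by
    intro v hv p hp q hq hpq ap aq hk
    obtain ⟨c', hc'⟩ := hcore.add hv hp hq hpq hk ap aq
    have hxv : x ≠ v := fun e => hv (e ▸ hx)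
    have hyv : y ≠ v := fun e => hv (e ▸ hy)
    have := hmax (insert v H) ⟨by simp [hx], by simp [hy], c', _, hc', by
      rw [Function.update_of_ne hxv, Function.update_of_ne hyv, hκ]⟩
    rw [Finset.card_insert_of_notMem hv] at this
    omega
  refine ⟨H, c, κ, hcore, ?_, ?_⟩
  · have sub : insert x (insert y W) ⊆ H := by
      intro v hv
      simp only [Finset.mem_insert] at hv
      rcases hv with rfl | rfl | hv
      · exact hx
      · exact hy
      · by_contra hvH
        simp only [hW, Finset.mem_filter, Finset.mem_univ, true_and] at hv
        exact ext v hvH x hx y hy hxy hv.1 hv.2 hκ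
    have := Finset.card_le_card sub
    rw [Finset.card_insert_of_notMem (by simp [hxy, hW]),
      Finset.card_insert_of_notMem (by simp [hW])] at this
    omega
  · intro v hv
    have := Finset.card_le_card_of_injOn (s := H.filter (fun w => G.Adj v w))
      (t := (Finset.univ : Finset Bool)) κ (fun _ _ => Finset.mem_coe.2 (Finset.mem_univ _)) (by
        intro p hp q hq hpq
        rw [Finset.mem_coe, Finset.mem_filter] at hp hq
        by_contra hne
        exact ext v hv p hp.1 q hq.1 hne hp.2 hq.2 hpq)
    simpa using this

theorem main_exists [DecidableEq V] [Fintype V] (G : SimpleGraph V) [DecidableRel G.Adj]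
    (hn : 14 ≤ Fintype.card V) (hc : G.Connected)
    (hE : (Fintype.card V).choose 2 + 10 ≤ G.edgeFinset.card + 3 * Fintype.card V) :
    ∃ c, PC G c Finset.univ := by
  obtain ⟨x, y, hxy, h5⟩ := exists_pair G hn hE
  obtain ⟨H, c, κ, hcore, h7, hdeg⟩ := exists_core G x y hxy h5
  have hHne : H.Nonempty := Finset.card_pos.1 (by omega)
  have split : ∀ v, (H.filter (fun w => G.Adj v w)).card + (H.filter (fun w => ¬ G.Adj v w)).card
      = H.card := fun v => Finset.card_filter_add_card_filter_not _
  have hcard : Hᶜ.card + H.card = Fintype.card V := Finset.card_compl_add_card H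
  have M : ∀ F : Finset (Sym2 V), (∀ e ∈ F, e ∈ Gᶜ.edgeFinset) → (∀ e ∈ F, ∀ z ∈ e, z ∉ H) →
      ∑ v ∈ Hᶜ, (H.filter (fun w => ¬ G.Adj v w)).card + F.card + 10 ≤ 3 * Fintype.card V := by
    intro F h1 h2
    have := count G H F h1 h2
    omega
  have two_of : ∀ v, 2 ≤ (H.filter (fun w => G.Adj v w)).card →
      ∃ x ∈ H, ∃ y ∈ H, x ≠ y ∧ G.Adj v x ∧ G.Adj v y := by
    intro v hv
    obtain ⟨p, hp, q, hq, hpq⟩ := Finset.one_lt_card.1 (show 1 < _ from hv)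
    simp only [Finset.mem_filter] at hp hq
    exact ⟨p, hp.1, q, hq.1, hpq, hp.2, hq.2⟩
  have low : Hᶜ.card * (H.card - 2) + 10 ≤ 3 * Fintype.card V := by
    have h0 := M ∅ (by simp) (by simp)
    have : Hᶜ.card • (H.card - 2) ≤ ∑ v ∈ Hᶜ, (H.filter (fun w => ¬ G.Adj v w)).card := by
      apply Finset.card_nsmul_le_sum
      intro v hv
      have := hdeg v (by simpa using hv)
      have := split v
      omega
    rw [smul_eq_mul] at this
    simp at h0
    omega
  set r := Hᶜ.card with hr
  obtain ⟨k, hk⟩ : ∃ k, H.card = k + 7 := ⟨H.card - 7, by omega⟩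
  have low' : r * (k + 5) + 10 ≤ 3 * (r + k + 7) := by
    rw [hk] at low hcard
    have e : k + 7 - 2 = k + 5 := by omega
    rw [e] at low
    omega
  have hr5 : r ≤ 4 := by
    by_contra hcon
    obtain ⟨s, hs⟩ : ∃ s, r = s + 5 := ⟨r - 5, by omega⟩
    rw [hs] at low'
    have hk0 : 2 * s + 2 * k + s * k ≤ 1 := by nlinarith
    have : s = 0 ∧ k = 0 := by
      constructor <;> nlinarith [Nat.zero_le (s * k)]
    omega
  have memR : ∀ v, v ∉ H ↔ v ∈ Hᶜ := by simp
  interval_cases hrr : r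
  · refine PC.uni hcore.pc ?_
    intro v
    by_contra hv
    rw [memR, Finset.card_eq_zero.1 hr.symm] at hv
    simp at hv
  · obtain ⟨a, ha⟩ := Finset.card_eq_one.1 hr.symm
    exact one' hcore hHne (a := a) (by intro v; rw [memR, ha]; simp) hc
  · obtain ⟨a, b, hab, ha⟩ := Finset.card_eq_two.1 hr.symm
    exact two' hcore hHne (a := a) (b := b) (by intro v; rw [memR, ha]; simp) hab hc
  · obtain ⟨a, b, d, hab, had, hbd, ha⟩ := Finset.card_eq_three.1 hr.symm
    have hR : ∀ v, v ∉ H ↔ v = a ∨ v = b ∨ v = d := by intro v; rw [memR, ha]; simp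
    have no : ∀ v, (¬ ∃ x ∈ H, G.Adj v x) → (H.filter (fun w => G.Adj v w)).card = 0 := by
      intro v hv
      rw [Finset.card_eq_zero, Finset.filter_eq_empty_iff]
      intro z hz hvz
      exact hv ⟨z, hz, hvz⟩
    have sum3 : ∀ a b d, a ∉ H → b ∉ H → d ∉ H → a ≠ b → a ≠ d → b ≠ d → ∀ f : V → ℕ,
        ∑ v ∈ Hᶜ, f v = f a + f b + f d := by
      intro a b d ha hb hd hab had hbd f
      have : ({a, b, d} : Finset V) = Hᶜ := by
        apply Finset.eq_of_subset_of_card_le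
        · intro z hz
          simp only [Finset.mem_insert, Finset.mem_singleton] at hz
          rcases hz with rfl | rfl | rfl <;> simpa
        · rw [← hr, Finset.card_eq_three.2 ⟨a, b, d, hab, had, hbd, rfl⟩]
      rw [← this, Finset.sum_insert (by simp [hab, had]), Finset.sum_insert (by simp [hbd]),
        Finset.sum_singleton, add_assoc]
    refine three hcore hHne hR hab had hbd hc ?_ ?_
    · intro a b d ha hb hd hab had hbd nb nd hbd'
      apply two_of
      have m := M {s(b, d)} (by simp [hbd, hbd']) (by simp [hb, hd])
      rw [sum3 a b d ha hb hd hab had hbd] at m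
      have s1 := split a
      have s2 := split b
      have s3 := split d
      rw [no b nb] at s2
      rw [no d nd] at s3
      simp only [Finset.card_singleton] at m
      omega
    · by_contra hcon
      push Not at hcon
      obtain ⟨h1, h2, h3, h4⟩ := hcon
      have le1 : ∀ v, v ∉ H → (H.filter (fun w => G.Adj v w)).card ≤ 1 := by
        intro v hv
        by_contra hh
        obtain ⟨x, hx, y, hy, hxy, ax, ay⟩ := two_of v (by omega)
        exact h1 v hv x hx y hy hxy ax ay
      have ha' := (hR a).2 (by simp)
      have hb' := (hR b).2 (by simp)
      have hd' := (hR d).2 (by simp)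
      have m := M {s(a, b), s(a, d), s(b, d)} (by simp [hab, had, hbd, h2, h3, h4])
        (by simp [ha', hb', hd'])
      rw [sum3 a b d ha' hb' hd' hab had hbd] at m
      have c3 : ({s(a, b), s(a, d), s(b, d)} : Finset (Sym2 V)).card = 3 := by
        apply Finset.card_eq_three.2
        refine ⟨_, _, _, ?_, ?_, ?_, rfl⟩
        · simp [hbd, hab, had, hab.symm, had.symm, hbd.symm]
        · simp [hbd, hab, had, hab.symm, had.symm, hbd.symm]
        · simp [hbd, hab, had, hab.symm, had.symm, hbd.symm]
      have s1 := split a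
      have s2 := split b
      have s3 := split d
      have l1 := le1 a ha'
      have l2 := le1 b hb'
      have l3 := le1 d hd'
      omega
  · -- four vertices outside
    have hk3 : k = 3 := by omega
    have ge : ∀ v, v ∉ H → 8 ≤ (H.filter (fun w => ¬ G.Adj v w)).card := by
      intro v hv
      have := hdeg v hv
      have := split v
      omega
    have lb : 32 ≤ ∑ v ∈ Hᶜ, (H.filter (fun w => ¬ G.Adj v w)).card := by
      have := Finset.card_nsmul_le_sum Hᶜ (fun v => (H.filter (fun w => ¬ G.Adj v w)).card) 8
        (fun v hv => ge v (by simpa using hv))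
      rw [← hr] at this
      simpa using this
    have clq : ∀ u v, u ∉ H → v ∉ H → u ≠ v → G.Adj u v := by
      intro u v hu hv huv
      by_contra hna
      have m := M {s(u, v)} (by simp [huv, hna]) (by simp [hu, hv])
      simp only [Finset.card_singleton] at m
      omega
    have att : ∀ v, v ∉ H → ∃ x, x ∈ H ∧ G.Adj v x := by
      intro v hv
      by_contra hno
      have h0 : (H.filter (fun w => G.Adj v w)).card = 0 := by
        rw [Finset.card_eq_zero, Finset.filter_eq_empty_iff]
        intro z hz hvz
        exact hno ⟨z, hz, hvz⟩
      have m := M ∅ (by simp) (by simp)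
      have e := Finset.add_sum_erase Hᶜ (fun v => (H.filter (fun w => ¬ G.Adj v w)).card)
        ((memR v).1 hv)
      have := Finset.card_nsmul_le_sum (Hᶜ.erase v)
        (fun v => (H.filter (fun w => ¬ G.Adj v w)).card) 8
        (fun v hv => ge v (by simpa using (Finset.mem_erase.1 hv).2))
      rw [Finset.card_erase_of_mem ((memR v).1 hv), ← hr] at this
      have s := split v
      simp only [Finset.card_empty, smul_eq_mul] at m this
      omega
    choose! f hf using att
    exact fin1 hcore (fun _ => True) (fun _ => False) f f (fun v hv _ => hf v hv)
      (fun v _ h => h.elim) (fun v _ _ h => h.elim) (fun v _ => Or.inl trivial)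
      (fun u v hu hv huv => Or.inr (Or.inr (clq u v hu hv huv)))

end aux

theorem stmt15 {V : Type*} [Fintype V] (G : SimpleGraph V)
    (hn : 14 ≤ Fintype.card V) (hconn : G.Connected)
    (hlow : Nat.choose (Fintype.card V - 3) 2 + 4 ≤ G.edgeSet.ncard)
    (hhigh : G.edgeSet.ncard ≤ Nat.choose (Fintype.card V) 2 - 1) :
    pc G = 2 := by
  classical
  have hcard : G.edgeSet.ncard = G.edgeFinset.card := by
    rw [← SimpleGraph.coe_edgeFinset, Set.ncard_coe_finset]
  rw [hcard] at hlow hhigh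
  have hch : (Fintype.card V).choose 2 + 6 =
      (Fintype.card V - 3).choose 2 + 3 * Fintype.card V := by
    obtain ⟨m, hm⟩ : ∃ m, Fintype.card V = m + 3 := ⟨Fintype.card V - 3, by omega⟩
    rw [hm]
    have a1 : (m + 3).choose 2 = (m + 2).choose 1 + (m + 2).choose 2 := rfl
    have a2 : (m + 2).choose 2 = (m + 1).choose 1 + (m + 1).choose 2 := rfl
    have a3 : (m + 1).choose 2 = m.choose 1 + m.choose 2 := rfl
    simp only [Nat.choose_one_right] at a1 a2 a3
    have : m + 3 - 3 = m := by omega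
    rw [this]
    omega
  apply pc_eq_two G (main_exists G hn hconn (by omega))
  by_contra hcon
  push Not at hcon
  have htop : G = ⊤ := by
    ext u v
    simp only [SimpleGraph.top_adj]
    exact ⟨fun h => h.ne, fun h => hcon u v h⟩
  have : G.edgeFinset.card = (Fintype.card V).choose 2 := by
    rw [← SimpleGraph.card_edgeFinset_top_eq_card_choose_two]
    congr!
  have pos : 0 < (Fintype.card V).choose 2 := Nat.choose_pos (by omega)
  omega
end

section
/- Let G be a connected graph of order n ≥ 14 with vertex connectivity at most 2 and with |E(G)| ≥ C(n−3, 2) + 4. Then the minimum degree of G satisfies δ(G) ≤ 5. -/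
theorem stmt18_deg {V : Type*} [Fintype V] [DecidableEq V] (G : SimpleGraph V)
    [DecidableRel G.Adj] (x : V) (T : Finset V) (hx : x ∉ T) (h : ∀ y ∈ T, ¬ G.Adj x y) :
    G.degree x + T.card + 1 ≤ Fintype.card V := by
  have h1 : Disjoint (G.neighborFinset x) (insert x T) := by
    rw [Finset.disjoint_left]
    intro y hy hy2
    rw [SimpleGraph.mem_neighborFinset] at hy
    rcases Finset.mem_insert.1 hy2 with rfl | h2
    · exact G.loopless.irrefl _ hy
    · exact h y h2 hy
  have h2 := Finset.card_le_univ (G.neighborFinset x ∪ insert x T)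
  rw [Finset.card_union_of_disjoint h1, Finset.card_insert_of_notMem hx,
    SimpleGraph.card_neighborFinset_eq_degree] at h2
  omega

theorem stmt18 {V : Type*} [Fintype V] [DecidableEq V] (G : SimpleGraph V)
    [DecidableRel G.Adj] [Nonempty V]
    (hconn : G.Connected) (hn : 14 ≤ Fintype.card V)
    (hκ : ∃ S : Set V, S.ncard ≤ 2 ∧
      (¬ (G.induce Sᶜ).Connected ∨ (Sᶜ : Set V).ncard ≤ 1))
    (hm : Nat.choose (Fintype.card V - 3) 2 + 4 ≤ G.edgeSet.ncard) :
    G.minDegree ≤ 5 := by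
  classical
  by_contra hδ
  have hδ' : ∀ v, 6 ≤ G.degree v := fun v => by
    have := G.minDegree_le_degree v
    omega
  obtain ⟨S, hS, hS2⟩ := hκ
  have hcard : S.ncard + Sᶜ.ncard = Fintype.card V := by
    rw [Set.ncard_add_ncard_compl, Nat.card_eq_fintype_card]
  have hnc : ¬ (G.induce Sᶜ).Connected := by
    rcases hS2 with h | h
    · exact h
    · omega
  have hne : Nonempty (Sᶜ : Set V) := by
    rw [Set.nonempty_coe_sort]
    apply Set.nonempty_of_ncard_ne_zero
    omega
  have hnp : ¬ (G.induce Sᶜ).Preconnected := fun h => hnc ⟨h⟩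
  unfold SimpleGraph.Preconnected at hnp
  push Not at hnp
  obtain ⟨u, v, huv⟩ := hnp
  let A : Finset V := Finset.univ.filter
    (fun x => ∃ h : x ∈ Sᶜ, (G.induce Sᶜ).Reachable u ⟨x, h⟩)
  let B : Finset V := Finset.univ.filter
    (fun x => ∃ h : x ∈ Sᶜ, ¬ (G.induce Sᶜ).Reachable u ⟨x, h⟩)
  let T : Finset V := Finset.univ.filter (fun x => x ∈ S)
  have hT : T.card = S.ncard := by
    rw [← Set.ncard_coe_finset]
    congr 1
    ext x
    simp [T]
  have hAB : Disjoint A B := by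
    rw [Finset.disjoint_left]
    intro x hx hy
    simp only [A, B, Finset.mem_filter] at hx hy
    obtain ⟨_, h1, h2⟩ := hx
    obtain ⟨_, h3, h4⟩ := hy
    exact h4 h2
  have hABT : Disjoint (A ∪ B) T := by
    rw [Finset.disjoint_left]
    intro x hx hy
    simp only [A, B, T, Finset.mem_filter, Finset.mem_union] at hx hy
    rcases hx with ⟨_, h1, h2⟩ | ⟨_, h1, h2⟩
    · exact h1 hy.2
    · exact h1 hy.2
  have huniv : (A ∪ B) ∪ T = Finset.univ := by
    ext x
    simp only [A, B, T, Finset.mem_filter, Finset.mem_union, Finset.mem_univ, true_and, iff_true]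
    by_cases hx : x ∈ S
    · exact Or.inr hx
    · left
      by_cases h : (G.induce Sᶜ).Reachable u ⟨x, hx⟩
      · exact Or.inl ⟨hx, h⟩
      · exact Or.inr ⟨hx, h⟩
  have hnadj : ∀ x ∈ A, ∀ y ∈ B, ¬ G.Adj x y := by
    intro x hx y hy hadj
    simp only [A, B, Finset.mem_filter] at hx hy
    obtain ⟨_, h1, h2⟩ := hx
    obtain ⟨_, h3, h4⟩ := hy
    apply h4
    refine h2.trans (SimpleGraph.Adj.reachable ?_)
    simpa using hadj
  have dA : ∀ x ∈ A, G.degree x + B.card + 1 ≤ Fintype.card V := fun x hx =>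
    stmt18_deg G x B (Finset.disjoint_left.1 hAB hx) (hnadj x hx)
  have dB : ∀ x ∈ B, G.degree x + A.card + 1 ≤ Fintype.card V := fun x hx =>
    stmt18_deg G x A (Finset.disjoint_right.1 hAB hx) (fun y hy h => hnadj y hy x hx h.symm)
  have dT : ∀ x ∈ T, G.degree x + 1 ≤ Fintype.card V := fun x _ => by
    simpa using stmt18_deg G x ∅ (by simp) (by simp)
  have hc : A.card + B.card + T.card = Fintype.card V := by
    rw [← Finset.card_union_of_disjoint hAB, ← Finset.card_union_of_disjoint hABT, huniv,
      Finset.card_univ]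
  have hu : u.1 ∈ A := by
    simp only [A, Finset.mem_filter, Finset.mem_univ, true_and]
    exact ⟨u.2, SimpleGraph.Reachable.refl _⟩
  have hv : v.1 ∈ B := by
    simp only [B, Finset.mem_filter, Finset.mem_univ, true_and]
    exact ⟨v.2, huv⟩
  have hA5 : 5 ≤ A.card := by
    have := dA _ hu
    have := hδ' u.1
    omega
  have hB5 : 5 ≤ B.card := by
    have := dB _ hv
    have := hδ' v.1
    omega
  have hsum := G.sum_degrees_eq_twice_card_edges
  rw [← huniv, Finset.sum_union hABT, Finset.sum_union hAB] at hsum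
  have hE : G.edgeSet.ncard = G.edgeFinset.card := by
    rw [← SimpleGraph.coe_edgeFinset, Set.ncard_coe_finset]
  rw [hE] at hm
  have sA := Finset.sum_le_card_nsmul A (fun x => G.degree x) (Fintype.card V - 1 - B.card)
    (fun x hx => by have := dA x hx; omega)
  have sB := Finset.sum_le_card_nsmul B (fun x => G.degree x) (Fintype.card V - 1 - A.card)
    (fun x hx => by have := dB x hx; omega)
  have sT := Finset.sum_le_card_nsmul T (fun x => G.degree x) (Fintype.card V - 1)
    (fun x hx => by have := dT x hx; omega)
  simp only [smul_eq_mul] at sA sB sT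
  rw [← hT] at hS
  have hch := Nat.choose_two_right (Fintype.card V - 3)
  have hev : 2 * (Fintype.card V - 3).choose 2
      = (Fintype.card V - 3) * (Fintype.card V - 3 - 1) := by
    rw [hch]
    exact Nat.mul_div_cancel' (Nat.even_mul_pred_self _).two_dvd
  have eA : Fintype.card V - 1 - B.card + B.card + 1 = Fintype.card V := by omega
  have eB : Fintype.card V - 1 - A.card + A.card + 1 = Fintype.card V := by omega
  have eT : Fintype.card V - 1 + 1 = Fintype.card V := by omega
  have e3 : Fintype.card V - 3 - 1 + 4 = Fintype.card V := by omega
  have e4 : Fintype.card V - 3 + 3 = Fintype.card V := by omega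
  generalize Fintype.card V - 1 - B.card = p at *
  generalize Fintype.card V - 1 - A.card = q at *
  generalize Fintype.card V - 1 = r at *
  generalize Fintype.card V - 3 - 1 = k at *
  generalize Fintype.card V - 3 = l at *
  generalize (l.choose 2) = ch at *
  generalize Fintype.card V = n at *
  generalize A.card = a at *
  generalize B.card = b at *
  generalize T.card = t at *
  have hab : (0:ℤ) ≤ ((a:ℤ) - 5) * ((b:ℤ) - 5) :=
    mul_nonneg (by linarith [(Nat.cast_le (α := ℤ)).2 hA5]) (by linarith [(Nat.cast_le (α := ℤ)).2 hB5])
  have key : 2 * (ch + 4) ≤ a * p + b * q + t * r := by omega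
  clear hch hsum sA sB sT hm
  zify at *
  have p1 : (p:ℤ) = n - 1 - b := by linarith
  have p2 : (q:ℤ) = n - 1 - a := by linarith
  have p3 : (r:ℤ) = n - 1 := by linarith
  have p4 : (k:ℤ) = n - 4 := by linarith
  have p5 : (l:ℤ) = n - 3 := by linarith
  have p6 : (t:ℤ) = n - a - b := by linarith
  rw [p1, p2, p3, p6] at key
  rw [p4, p5] at hev
  rw [p6] at hS
  ring_nf at key hev hab
  linarith
end
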